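/- arXiv:1803.05411 — 4 statements merged into one kernel-verified Lean document; each statement's English description precedes it below -/
import Mathlib

section
/- Fix t ∈ (0,1) and let μ : [0,1] → ℝ be twice continuously differentiable. Let K : ℝ → ℝ be continuously differentiable on [−1,1], zero outside [−1,1], with K ≥ 0, ∫_{−1}^{1} K(x) dx = 1, ∫_{−1}^{1} x K(x) dx = 0. Let (b_m) be bandwidths with b_m → 0 and for each m let 0 = t_{m,0} < … < t_{m,N_m} = 1 be a partition with spacings at most β_m^{−1}, where β_m → ∞ and b_m^{3} β_m → ∞. Then b_m^{−2} · [ b_m^{−1} Σ_{j=1}^{N_m} (t_{m,j} − t_{m,j−1}) K((t_{m,j} − t)/b_m) μ(t_{m,j}) − μ(t) ] converges to (μ''(t)/2) ∫_{−1}^{1} x^2 K(x) dx as m → ∞. -/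
open MeasureTheory Set Filter Finset

/-- The right-endpoint Riemann sum of `f` differs from the integral by at most the mesh times the
increment of any function dominating the oscillation of `f` on the cells. -/
theorem abs_riemannSum_sub_integral_le {f g : ℝ → ℝ} {p : ℕ → ℝ} {n : ℕ} {δ : ℝ}
    (hp : ∀ j < n, p j ≤ p (j + 1)) (hδ : ∀ j < n, p (j + 1) - p j ≤ δ)
    (hf : ∀ j < n, IntervalIntegrable f volume (p j) (p (j + 1)))
    (hfg : ∀ j < n, ∀ x ∈ Set.Icc (p j) (p (j + 1)),
      |f x - f (p (j + 1))| ≤ g (p (j + 1)) - g (p j)) :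
    |∑ j ∈ Finset.range n, (p (j + 1) - p j) * f (p (j + 1)) - ∫ x in (p 0)..(p n), f x| ≤
      δ * (g (p n) - g (p 0)) := by
  rw [← intervalIntegral.sum_integral_adjacent_intervals hf, ← Finset.sum_sub_distrib,
    ← Finset.sum_range_sub (fun j => g (p j)), Finset.mul_sum]
  refine (Finset.abs_sum_le_sum_abs _ _).trans (Finset.sum_le_sum fun j hj => ?_)
  have hj := Finset.mem_range.1 hj
  have hcell : (p (j + 1) - p j) * f (p (j + 1)) - ∫ x in (p j)..(p (j + 1)), f x =
      -∫ x in (p j)..(p (j + 1)), (f x - f (p (j + 1))) := by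
    rw [intervalIntegral.integral_sub (hf j hj) (by simp)]
    simp
  rw [hcell, abs_neg]
  have hbound := intervalIntegral.norm_integral_le_of_norm_le_const (a := p j) (b := p (j + 1))
    (f := fun x => f x - f (p (j + 1))) (C := g (p (j + 1)) - g (p j)) fun x hx => by
      rw [Set.uIoc_of_le (hp j hj)] at hx
      exact hfg j hj x (Set.Ioc_subset_Icc_self hx)
  rw [abs_of_nonneg (sub_nonneg.2 (hp j hj)), Real.norm_eq_abs] at hbound
  refine hbound.trans ?_
  rw [mul_comm]
  refine mul_le_mul_of_nonneg_right (hδ j hj) ?_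
  exact (abs_nonneg _).trans (hfg j hj (p (j + 1)) ⟨hp j hj, le_rfl⟩)

/-- A bounded function that is Lipschitz on `[-1, 1]` and vanishes elsewhere has its increments
dominated by those of a bounded function. -/
theorem exists_dominating_of_lipschitzOn_Icc {K : ℝ → ℝ} {L M : ℝ}
    (hL : 0 ≤ L) (hlip : ∀ x ∈ Set.Icc (-1 : ℝ) 1, ∀ y ∈ Set.Icc (-1 : ℝ) 1,
      |K x - K y| ≤ L * |x - y|)
    (hM : ∀ x, |K x| ≤ M) (hsupp : ∀ x ∉ Set.Icc (-1 : ℝ) 1, K x = 0) :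
    ∃ P : ℝ → ℝ, (∀ x y, x ≤ y → |K x - K y| ≤ P y - P x) ∧
      ∀ x y, P y - P x ≤ 2 * L + 2 * M := by
  have hM0 : 0 ≤ M := (abs_nonneg _).trans (hM 0)
  refine ⟨fun x => L * max (-1) (min 1 x) + (if -1 ≤ x then M else 0) + (if 1 < x then M else 0),
    fun x y hxy => ?_, fun x y => ?_⟩
  · have hclamp : L * max (-1) (min 1 x) ≤ L * max (-1) (min 1 y) := by gcongr
    by_cases hx : x ∈ Set.Icc (-1 : ℝ) 1
    · by_cases hy : y ∈ Set.Icc (-1 : ℝ) 1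
      · have h := hlip x hx y hy
        rw [abs_of_nonpos (sub_nonpos.2 hxy)] at h
        simp only [hx.1, hy.1, not_lt.2 hx.2, not_lt.2 hy.2, min_eq_right hx.2,
          min_eq_right hy.2, max_eq_right hx.1, max_eq_right hy.1, if_true, if_false]
        linarith
      · have hy1 : 1 < y := by
          by_contra! h
          exact hy ⟨hx.1.trans hxy, h⟩
        have h := hM x
        simp only [hx.1, hx.1.trans hxy, not_lt.2 hx.2, hy1, hsupp y hy, sub_zero, if_true,
          if_false]
        linarith
    · by_cases hy : y ∈ Set.Icc (-1 : ℝ) 1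
      · have hx1 : x < -1 := by
          by_contra! h
          exact hx ⟨h, hxy.trans hy.2⟩
        have h := hM y
        simp only [not_le.2 hx1, hy.1, not_lt.2 hy.2, not_lt.2 (hxy.trans hy.2), hsupp x hx,
          zero_sub, abs_neg, if_true, if_false]
        linarith
      · rw [hsupp x hx, hsupp y hy, sub_zero, abs_zero]
        dsimp only
        split_ifs <;> linarith
  · have h1 : L * max (-1) (min 1 y) ≤ L * 1 := by
      gcongr
      exact max_le (by norm_num) (min_le_left _ _)
    have h2 : L * (-1) ≤ L * max (-1) (min 1 x) := by
      gcongr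
      exact le_max_left _ _
    dsimp only
    split_ifs <;> linarith

/-- Second-order bias expansion of the smoothed function `∫ K(u) f(t + h u) du` for a nonnegative
kernel of order two. -/
theorem tendsto_smoothing_bias {t : ℝ} (ht : t ∈ Set.Ioo (0 : ℝ) 1) {f K : ℝ → ℝ}
    (hf : ContDiffOn ℝ 2 f (Set.Icc (0 : ℝ) 1)) (hK : ContinuousOn K (Set.Icc (-1 : ℝ) 1))
    (hKpos : ∀ x, 0 ≤ K x) (hKnorm : ∫ x in (-1 : ℝ)..1, K x = 1)
    (hKmom : ∫ x in (-1 : ℝ)..1, x * K x = 0) :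
    Tendsto (fun h : ℝ => ((∫ u in (-1 : ℝ)..1, K u * f (h * u + t)) - f t) / h ^ 2)
      (nhdsWithin 0 (Set.Ioi 0))
      (nhds (iteratedDerivWithin 2 f (Set.Icc (0 : ℝ) 1) t / 2 *
        ∫ x in (-1 : ℝ)..1, x ^ 2 * K x)) := by
  have hT := taylor_isLittleO (n := 2) (convex_Icc (0 : ℝ) 1) (Set.Ioo_subset_Icc_self ht)
    (by exact_mod_cast hf)
  rw [nhdsWithin_eq_nhds.2 (Icc_mem_nhds ht.1 ht.2)] at hT
  simp only [taylorWithinEval_succ, taylor_within_zero_eval] at hT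
  set c₁ := iteratedDerivWithin 1 f (Set.Icc (0 : ℝ) 1) t with hc₁
  set c₂ := iteratedDerivWithin 2 f (Set.Icc (0 : ℝ) 1) t with hc₂
  rw [Metric.tendsto_nhds]
  intro ε hε
  have hT' := hT.def (half_pos hε)
  obtain ⟨r, hr, hTr⟩ := Metric.eventually_nhds_iff.1 hT'
  have hsmall : ∀ᶠ h : ℝ in nhdsWithin 0 (Set.Ioi 0),
      h < r ∧ h < t ∧ h < 1 - t :=
    nhdsWithin_le_nhds ((gt_mem_nhds hr).and ((gt_mem_nhds ht.1).and
      (gt_mem_nhds (sub_pos.2 ht.2))))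
  filter_upwards [hsmall, self_mem_nhdsWithin] with h ⟨hhr, hht, hht'⟩ hh
  have hh : 0 < h := hh
  have hK' : ContinuousOn K (Set.uIcc (-1 : ℝ) 1) := by rwa [Set.uIcc_of_le (by norm_num)]
  have hmaps : Set.MapsTo (fun u : ℝ => h * u + t) (Set.uIcc (-1 : ℝ) 1) (Set.Icc 0 1) := by
    intro u hu
    rw [Set.uIcc_of_le (by norm_num)] at hu
    constructor <;> nlinarith [hu.1, hu.2]
  have hf' : ContinuousOn (fun u : ℝ => f (h * u + t)) (Set.uIcc (-1 : ℝ) 1) :=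
    hf.continuousOn.comp (by fun_prop) hmaps
  have hrem : (∫ u in (-1 : ℝ)..1, K u * f (h * u + t)) - f t -
      h ^ 2 * (c₂ / 2 * ∫ x in (-1 : ℝ)..1, x ^ 2 * K x) =
      ∫ u in (-1 : ℝ)..1, K u * (f (h * u + t) - (f t + c₁ * (h * u) + c₂ / 2 * (h * u) ^ 2)) := by
    have hexp : ∀ u : ℝ, K u * (f (h * u + t) - (f t + c₁ * (h * u) + c₂ / 2 * (h * u) ^ 2)) =
        K u * f (h * u + t) - (f t * K u + c₁ * h * (u * K u) +
          h ^ 2 * c₂ / 2 * (u ^ 2 * K u)) := fun u => by ring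
    simp_rw [hexp]
    have i1 : IntervalIntegrable (fun u => f t * K u) volume (-1) 1 :=
      ContinuousOn.intervalIntegrable (by fun_prop)
    have i2 : IntervalIntegrable (fun u => c₁ * h * (u * K u)) volume (-1) 1 :=
      ContinuousOn.intervalIntegrable (by fun_prop)
    have i3 : IntervalIntegrable (fun u => h ^ 2 * c₂ / 2 * (u ^ 2 * K u)) volume (-1) 1 :=
      ContinuousOn.intervalIntegrable (by fun_prop)
    have i0 : IntervalIntegrable (fun u => K u * f (h * u + t)) volume (-1) 1 :=
      (hK'.mul hf').intervalIntegrable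
    rw [intervalIntegral.integral_sub i0 ((i1.add i2).add i3),
      intervalIntegral.integral_add (i1.add i2) i3, intervalIntegral.integral_add i1 i2,
      intervalIntegral.integral_const_mul, intervalIntegral.integral_const_mul,
      intervalIntegral.integral_const_mul, hKnorm, hKmom]
    ring
  have hbound : |∫ u in (-1 : ℝ)..1,
      K u * (f (h * u + t) - (f t + c₁ * (h * u) + c₂ / 2 * (h * u) ^ 2))| ≤ ε / 2 * h ^ 2 := by
    rw [← Real.norm_eq_abs]
    have hle : ∫ u in (-1 : ℝ)..1, K u * (ε / 2 * h ^ 2) = ε / 2 * h ^ 2 := by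
      rw [intervalIntegral.integral_mul_const, hKnorm, one_mul]
    rw [← hle]
    refine intervalIntegral.norm_integral_le_of_norm_le (by norm_num) (ae_of_all _ fun u hu => ?_)
      (ContinuousOn.intervalIntegrable (by fun_prop))
    have habs : |u| ≤ 1 := abs_le.2 ⟨hu.1.le, hu.2⟩
    have hdist : dist (h * u + t) t < r := by
      rw [Real.dist_eq, add_sub_cancel_right, abs_mul, abs_of_pos hh]
      nlinarith
    have hu2 : u ^ 2 ≤ 1 := (sq_le_one_iff_abs_le_one u).2 habs
    have h2 := hTr hdist
    rw [norm_mul, Real.norm_of_nonneg (hKpos u)]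
    refine mul_le_mul_of_nonneg_left ?_ (hKpos u)
    have hpoly : f (h * u + t) - (f t + c₁ * (h * u) + c₂ / 2 * (h * u) ^ 2) =
        f (h * u + t) - (f t + (((0 : ℕ) + 1 : ℝ) * (Nat.factorial 0 : ℕ))⁻¹ *
          (h * u + t - t) ^ (0 + 1) * c₁ + (((1 : ℕ) + 1 : ℝ) * (Nat.factorial 1 : ℕ))⁻¹ *
          (h * u + t - t) ^ (1 + 1) * c₂) := by
      simp
      ring
    rw [hpoly]
    refine (le_trans (le_of_eq ?_) h2).trans ?_
    · simp [hc₁, hc₂]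
    · rw [add_sub_cancel_right, norm_pow, Real.norm_eq_abs, sq_abs, mul_pow]
      have : h ^ 2 * u ^ 2 ≤ h ^ 2 * 1 := by gcongr
      nlinarith
  rw [← hrem] at hbound
  rw [Real.dist_eq]
  have hh2 : 0 < h ^ 2 := by positivity
  have hdiv : ((∫ u in (-1 : ℝ)..1, K u * f (h * u + t)) - f t) / h ^ 2 -
      c₂ / 2 * ∫ x in (-1 : ℝ)..1, x ^ 2 * K x =
      ((∫ u in (-1 : ℝ)..1, K u * f (h * u + t)) - f t -
      h ^ 2 * (c₂ / 2 * ∫ x in (-1 : ℝ)..1, x ^ 2 * K x)) / h ^ 2 := by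
    field_simp
  rw [hdiv, abs_div, abs_of_pos hh2, div_lt_iff₀ hh2]
  nlinarith

/-- Change of variables for a kernel supported in `[-1, 1]` whose rescaled support stays inside
`[0, 1]`. -/
theorem integral_rescaled_kernel {K : ℝ → ℝ} (hsupp : ∀ x ∉ Set.Icc (-1 : ℝ) 1, K x = 0)
    (f : ℝ → ℝ) {t h : ℝ} (hh : 0 < h) (h0 : h ≤ t) (h1 : h ≤ 1 - t) :
    ∫ s in (0 : ℝ)..1, K ((s - t) / h) * f s = h * ∫ u in (-1 : ℝ)..1, K u * f (h * u + t) := by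
  have hcv := intervalIntegral.smul_integral_comp_mul_add
    (a := -1) (b := 1) (fun s => K ((s - t) / h) * f s) h t
  have hcancel : ∀ u : ℝ, (h * u + t - t) / h = u := fun u => by field_simp; ring
  simp only [hcancel, smul_eq_mul] at hcv
  rw [hcv, intervalIntegral.integral_of_le zero_le_one, intervalIntegral.integral_of_le (by linarith),
    ← integral_Icc_eq_integral_Ioc, ← integral_Icc_eq_integral_Ioc]
  refine setIntegral_eq_of_subset_of_forall_sdiff_eq_zero measurableSet_Icc
    (Set.Icc_subset_Icc (by linarith) (by linarith)) fun s hs => ?_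
  rw [hsupp _ fun hmem => hs.2 ?_, zero_mul]
  obtain ⟨hl, hr⟩ := hmem
  rw [le_div_iff₀ hh] at hl
  rw [div_le_iff₀ hh] at hr
  constructor <;> linarith

/-- The Riemann sum of a rescaled kernel times a Lipschitz function approximates its integral up to
a constant times the mesh, uniformly in the location and the bandwidth. -/
theorem exists_riemannSum_rescaled_kernel_bound {f K : ℝ → ℝ}
    (hf : ContDiffOn ℝ 1 f (Set.Icc (0 : ℝ) 1)) (hK : ContDiffOn ℝ 1 K (Set.Icc (-1 : ℝ) 1))
    (hsupp : ∀ x ∉ Set.Icc (-1 : ℝ) 1, K x = 0) :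
    ∃ C : ℝ, ∀ (t h δ : ℝ) (n : ℕ) (p : ℕ → ℝ), 0 < h → 0 ≤ δ → p 0 = 0 → p n = 1 →
      (∀ j < n, p j < p (j + 1)) → (∀ j < n, p (j + 1) - p j ≤ δ) →
      |∑ j ∈ Finset.range n, (p (j + 1) - p j) * (K ((p (j + 1) - t) / h) * f (p (j + 1))) -
        ∫ s in (0 : ℝ)..1, K ((s - t) / h) * f s| ≤ C * δ := by
  obtain ⟨L, hL⟩ := hK.exists_lipschitzOnWith one_ne_zero (convex_Icc _ _) isCompact_Icc
  obtain ⟨Lf, hLf⟩ := hf.exists_lipschitzOnWith one_ne_zero (convex_Icc _ _) isCompact_Icc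
  obtain ⟨MK, hMK⟩ := isCompact_Icc.exists_bound_of_continuousOn hK.continuousOn
  obtain ⟨Mf, hMf⟩ := isCompact_Icc.exists_bound_of_continuousOn hf.continuousOn
  have hMK0 : 0 ≤ MK := (norm_nonneg _).trans (hMK 0 (by norm_num))
  have hMf0 : 0 ≤ Mf := (norm_nonneg _).trans (hMf 0 (by norm_num))
  have hMK' : ∀ x, |K x| ≤ MK := fun x => by
    by_cases hx : x ∈ Set.Icc (-1 : ℝ) 1
    · exact hMK x hx
    · rwa [hsupp x hx, abs_zero]
  obtain ⟨P, hP, hPb⟩ := exists_dominating_of_lipschitzOn_Icc L.coe_nonneg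
    (fun x hx y hy => hL.dist_le_mul x hx y hy) hMK' hsupp
  have hKint : Integrable K :=
    hK.continuousOn.integrableOn_Icc.integrable_of_forall_notMem_eq_zero hsupp
  refine ⟨Mf * (2 * L + 2 * MK) + MK * Lf, fun t h δ n p hh hδ hp0 hpn hp hpδ => ?_⟩
  have hmono : ∀ i j, i ≤ j → j ≤ n → p i ≤ p j := fun i j hij => by
    induction j, hij using Nat.le_induction with
    | base => exact fun _ => le_rfl
    | succ k _ ih => exact fun hk => (ih (by omega)).trans (hp k (by omega)).le
  have hcell : ∀ j < n, Set.Icc (p j) (p (j + 1)) ⊆ Set.Icc 0 1 := fun j hj =>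
    Set.Icc_subset_Icc (hp0 ▸ hmono 0 j (by omega) hj.le) (hpn ▸ hmono (j + 1) n hj le_rfl)
  have hbound := abs_riemannSum_sub_integral_le (f := fun s => K ((s - t) / h) * f s)
    (g := fun s => Mf * P ((s - t) / h) + MK * Lf * s) (fun j hj => (hp j hj).le) hpδ
    (fun j hj => ((hKint.comp_div hh.ne').comp_sub_right t).intervalIntegrable.mul_continuousOn
      (hf.continuousOn.mono (by rw [Set.uIcc_of_le (hp j hj).le]; exact hcell j hj)))
    (fun j hj x hx => by
      set y := p (j + 1)
      have hx01 := hcell j hj hx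
      have hy01 : y ∈ Set.Icc (0 : ℝ) 1 := hcell j hj ⟨(hp j hj).le, le_rfl⟩
      have hK1 := hP ((x - t) / h) ((y - t) / h) (by gcongr; exact hx.2)
      have hK2 := (abs_nonneg _).trans
        (hP ((p j - t) / h) ((x - t) / h) (by gcongr; exact hx.1))
      have hf1 : |f x - f y| ≤ Lf * (y - p j) := by
        have h := hLf.dist_le_mul x hx01 y hy01
        rw [Real.dist_eq, Real.dist_eq, abs_of_nonpos (sub_nonpos.2 hx.2)] at h
        refine h.trans ?_
        gcongr
        linarith [hx.1]
      have hsplit : K ((x - t) / h) * f x - K ((y - t) / h) * f y =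
          (K ((x - t) / h) - K ((y - t) / h)) * f x + K ((y - t) / h) * (f x - f y) := by ring
      rw [hsplit]
      calc _ ≤ |K ((x - t) / h) - K ((y - t) / h)| * |f x| + |K ((y - t) / h)| * |f x - f y| := by
            rw [← abs_mul, ← abs_mul]
            exact abs_add_le _ _
        _ ≤ (P ((y - t) / h) - P ((p j - t) / h)) * Mf + MK * (Lf * (y - p j)) := by
            gcongr
            · linarith [(abs_nonneg _).trans hK1]
            · linarith
            · exact hMf x hx01
            · exact hMK' _
        _ = _ := by ring)
  rw [hp0, hpn] at hbound
  refine hbound.trans ?_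
  rw [mul_comm]
  refine mul_le_mul_of_nonneg_right ?_ hδ
  have h := mul_le_mul_of_nonneg_left (hPb ((0 - t) / h) ((1 - t) / h)) hMf0
  linarith

/-- Bias statement of the Corollary to Theorem 1 (case `v = 0`, `k = 2`): for a
second-order kernel `K`, `b⁻² (E[μ̂(t)] - μ(t)) → (μ''(t)/2) ∫ x² K(x) dx`. -/
theorem stmt_5 (t : ℝ) (ht : t ∈ Set.Ioo (0 : ℝ) 1)
    (μ : ℝ → ℝ) (hμ : ContDiffOn ℝ 2 μ (Set.Icc (0 : ℝ) 1))
    (K : ℝ → ℝ) (hK : ContDiffOn ℝ 1 K (Set.Icc (-1 : ℝ) 1))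
    (hKsupp : ∀ x : ℝ, x ∉ Set.Icc (-1 : ℝ) 1 → K x = 0)
    (hKpos : ∀ x : ℝ, 0 ≤ K x)
    (hKnorm : ∫ x in (-1 : ℝ)..1, K x = 1)
    (hKmom : ∫ x in (-1 : ℝ)..1, x * K x = 0)
    (b β : ℕ → ℝ) (N : ℕ → ℕ) (tp : ℕ → ℕ → ℝ)
    (hbpos : ∀ m, 0 < b m) (hb0 : Tendsto b atTop (nhds 0))
    (hpart0 : ∀ m, tp m 0 = 0) (hpart1 : ∀ m, tp m (N m) = 1)
    (hmono : ∀ m, ∀ j < N m, tp m j < tp m (j + 1))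
    (hmesh : ∀ m, ∀ j < N m, tp m (j + 1) - tp m j ≤ (β m)⁻¹)
    (hβ : Tendsto β atTop atTop)
    (hbβ : Tendsto (fun m => b m ^ 3 * β m) atTop atTop) :
    Tendsto
      (fun m =>
        ((b m)⁻¹ *
            ∑ j ∈ Finset.range (N m),
              (tp m (j + 1) - tp m j) * K ((tp m (j + 1) - t) / b m) * μ (tp m (j + 1)) -
          μ t) / b m ^ 2)
      atTop
      (nhds (iteratedDerivWithin 2 μ (Set.Icc (0 : ℝ) 1) t / 2 *
        ∫ x in (-1 : ℝ)..1, x ^ 2 * K x)) := by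
  obtain ⟨C, hC⟩ := exists_riemannSum_rescaled_kernel_bound (hμ.of_le (by norm_num)) hK hKsupp
  have hbias := (tendsto_smoothing_bias ht hμ hK.continuousOn hKpos hKnorm hKmom).comp
    (tendsto_nhdsWithin_iff.2 ⟨hb0, Eventually.of_forall hbpos⟩)
  refine hbias.congr_dist (squeeze_zero' (Eventually.of_forall fun _ => dist_nonneg) ?_
    (by simpa using hbβ.inv_tendsto_atTop.const_mul C))
  filter_upwards [hβ.eventually_gt_atTop 0, hb0.eventually_lt_const ht.1,
    hb0.eventually_lt_const (sub_pos.2 ht.2)] with m hβm hbt hbt'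
  have hb := hbpos m
  have hS := hC t (b m) (β m)⁻¹ (N m) (tp m) hb (inv_nonneg.2 hβm.le) (hpart0 m) (hpart1 m)
    (hmono m) (hmesh m)
  rw [integral_rescaled_kernel hKsupp μ hb hbt.le hbt'.le] at hS
  simp only [← mul_assoc] at hS
  rw [dist_comm, Real.dist_eq]
  dsimp only [Function.comp_apply, Pi.inv_apply]
  set S := ∑ j ∈ Finset.range (N m),
    (tp m (j + 1) - tp m j) * K ((tp m (j + 1) - t) / b m) * μ (tp m (j + 1))
  set J := ∫ u in (-1 : ℝ)..1, K u * μ (b m * u + t)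
  have hdiff : ((b m)⁻¹ * S - μ t) / b m ^ 2 - (J - μ t) / b m ^ 2 =
      (S - b m * J) / b m ^ 3 := by
    field_simp
    ring
  have hb3 : 0 < b m ^ 3 := by positivity
  rw [hdiff, abs_div, abs_of_pos hb3, ← mul_assoc, ← div_eq_mul_inv]
  gcongr
end

section
/- Let α ∈ (−1,0), let g : ℝ → ℝ be continuous on [−1,1] and zero outside [−1,1], and fix t ∈ (0,1). Let (N_m) be natural numbers and (b_m) bandwidths with N_m → ∞, b_m → 0, and N_m b_m → ∞. Then (N_m b_m)^{−2} Σ_{1 ≤ j₁ ≠ j₂ ≤ N_m} g((j₁/N_m − t)/b_m) · g((j₂/N_m − t)/b_m) · (|j₁ − j₂|/(N_m b_m))^{α} converges, as m → ∞, to ∫_{−1}^{1} ∫_{−1}^{1} g(x) g(y) |x−y|^{α} dx dy. -/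
open MeasureTheory Set Filter Finset

/-- The smallest point of the grid `h ℤ - s` that is at least `x`. -/
noncomputable def gridCeil (h s x : ℝ) : ℝ := h * ⌈(x + s) / h⌉ - s

lemma le_gridCeil {h : ℝ} (hh : 0 < h) (s x : ℝ) : x ≤ gridCeil h s x := by
  have h1 := Int.le_ceil ((x + s) / h)
  rw [div_le_iff₀ hh] at h1
  unfold gridCeil
  linarith

lemma gridCeil_lt_add {h : ℝ} (hh : 0 < h) (s x : ℝ) : gridCeil h s x < x + h := by
  have h1 := Int.ceil_lt_add_one ((x + s) / h)
  have h2 : h * (⌈(x + s) / h⌉ : ℝ) < h * ((x + s) / h + 1) := mul_lt_mul_of_pos_left h1 hh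
  have h3 : h * ((x + s) / h + 1) = x + s + h := by field_simp
  unfold gridCeil
  linarith

lemma abs_sub_le_two_mul_abs_gridCeil_sub {h : ℝ} (hh : 0 < h) {s x y : ℝ}
    (hne : gridCeil h s x ≠ gridCeil h s y) :
    |x - y| ≤ 2 * |gridCeil h s x - gridCeil h s y| := by
  have hge : h ≤ |gridCeil h s x - gridCeil h s y| := by
    have hne' : ⌈(x + s) / h⌉ - ⌈(y + s) / h⌉ ≠ 0 := by
      intro h0
      exact hne (by unfold gridCeil; rw [sub_eq_zero.1 h0])
    have h1 : (1 : ℝ) ≤ |(⌈(x + s) / h⌉ : ℝ) - ⌈(y + s) / h⌉| := by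
      exact_mod_cast Int.one_le_abs hne'
    have h2 : gridCeil h s x - gridCeil h s y = h * ((⌈(x + s) / h⌉ : ℝ) - ⌈(y + s) / h⌉) := by
      unfold gridCeil; ring
    rw [h2, abs_mul, abs_of_pos hh]
    exact le_mul_of_one_le_right hh.le h1
  have hx := le_gridCeil hh s x
  have hx' := gridCeil_lt_add hh s x
  have hy := le_gridCeil hh s y
  have hy' := gridCeil_lt_add hh s y
  have h3 := le_abs_self (gridCeil h s x - gridCeil h s y)
  have h4 := neg_abs_le (gridCeil h s x - gridCeil h s y)
  rw [abs_le]
  constructor <;> linarith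

lemma tendsto_gridCeil {ι : Type*} {l : Filter ι} {h s : ι → ℝ} (hpos : ∀ᶠ i in l, 0 < h i)
    (h0 : Tendsto h l (nhds 0)) (x : ℝ) :
    Tendsto (fun i => gridCeil (h i) (s i) x) l (nhds x) := by
  refine tendsto_of_tendsto_of_tendsto_of_le_of_le' tendsto_const_nhds
    (by simpa using tendsto_const_nhds.add h0) ?_ ?_
  · exact hpos.mono fun i hi => le_gridCeil hi _ _
  · exact hpos.mono fun i hi => (gridCeil_lt_add hi _ _).le

lemma integral_comp_ceil_prod {h : ℝ} (hh : 0 < h) (s : ℝ) (a : ℤ → ℤ → ℝ) (S : Finset ℤ)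
    (ha : ∀ i j, ¬ (i ∈ S ∧ j ∈ S) → a i j = 0) :
    ∫ p : ℝ × ℝ, a ⌈(p.1 + s) / h⌉ ⌈(p.2 + s) / h⌉ = h ^ 2 * ∑ i ∈ S, ∑ j ∈ S, a i j := by
  have hset (i : ℤ) : {x : ℝ | ⌈(x + s) / h⌉ = i} = Set.Ioc (h * (i - 1) - s) (h * i - s) := by
    ext x
    simp only [Set.mem_ofPred_eq, Int.ceil_eq_iff, Set.mem_Ioc, lt_div_iff₀ hh, div_le_iff₀ hh]
    constructor <;> rintro ⟨h1, h2⟩ <;> constructor <;> linarith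
  set R : ℤ → ℤ → Set (ℝ × ℝ) := fun i j =>
    {x : ℝ | ⌈(x + s) / h⌉ = i} ×ˢ {x : ℝ | ⌈(x + s) / h⌉ = j} with hR
  have hRm (i j : ℤ) : MeasurableSet (R i j) := by
    simp only [hR, hset]
    exact measurableSet_Ioc.prod measurableSet_Ioc
  have hRv (i j : ℤ) : volume.real (R i j) = h ^ 2 := by
    have hv (i : ℤ) : h * (i : ℝ) - s - (h * (i - 1) - s) = h := by ring
    simp only [hR, hset, Measure.volume_eq_prod, measureReal_prod_prod, Real.volume_real_Ioc, hv,
      max_eq_left hh.le]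
    ring
  have hRf (i j : ℤ) : volume (R i j) ≠ ⊤ := by
    intro htop
    have h0 := hRv i j
    rw [Measure.real, htop, ENNReal.toReal_top] at h0
    exact (pow_pos hh 2).ne h0
  have hpt (p : ℝ × ℝ) : a ⌈(p.1 + s) / h⌉ ⌈(p.2 + s) / h⌉ =
      ∑ i ∈ S, ∑ j ∈ S, (R i j).indicator (fun _ => a i j) p := by
    have hind (i j : ℤ) : (R i j).indicator (fun _ => a i j) p =
        if ⌈(p.1 + s) / h⌉ = i then (if ⌈(p.2 + s) / h⌉ = j then a i j else 0) else 0 := by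
      simp only [hR, Set.indicator_apply, Set.mem_prod, Set.mem_ofPred_eq, ite_and]
    simp only [hind]
    by_cases h1 : ⌈(p.1 + s) / h⌉ ∈ S ∧ ⌈(p.2 + s) / h⌉ ∈ S
    · rw [Finset.sum_eq_single_of_mem _ h1.1, Finset.sum_eq_single_of_mem _ h1.2]
      · simp
      · intro j _ hj
        simp [hj.symm]
      · intro i _ hi
        simp [hi.symm]
    · rw [ha _ _ h1]
      refine (Finset.sum_eq_zero fun i hi => Finset.sum_eq_zero fun j hj => ?_).symm
      split_ifs with h2 h3
      · exact absurd ⟨h2 ▸ hi, h3 ▸ hj⟩ h1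
      · rfl
      · rfl
  have hint (i j : ℤ) : Integrable ((R i j).indicator fun _ => a i j) :=
    (integrable_indicator_iff (hRm i j)).2 (integrableOn_const (hRf i j))
  simp only [hpt]
  rw [integral_finsetSum _ fun i _ => integrable_finsetSum _ fun j _ => hint i j]
  simp only [integral_finsetSum _ fun j _ => hint _ j, integral_indicator (hRm _ _),
    setIntegral_const, hRv, smul_eq_mul, Finset.mul_sum]

lemma integrable_indicator_abs_rpow {α : ℝ} (hα : -1 < α) {r : ℝ} (hr : 0 ≤ r) :
    Integrable ((Set.Icc (-r) r).indicator fun u : ℝ => |u| ^ α) := by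
  rw [integrable_indicator_iff measurableSet_Icc]
  have h1 : IntervalIntegrable (fun u : ℝ => |u| ^ α) volume 0 r := by
    refine (intervalIntegral.intervalIntegrable_rpow' (a := 0) (b := r) hα).congr ?_
    intro u hu
    rw [Set.uIoc_of_le hr] at hu
    simp [abs_of_pos hu.1]
  have h2 : IntervalIntegrable (fun u : ℝ => |u| ^ α) volume (-r) 0 := by
    have := ((IntervalIntegrable.iff_comp_neg (by simp)).1 h1).symm
    simpa using this
  have h3 := h2.trans h1
  rwa [intervalIntegrable_iff_integrableOn_Icc_of_le (by linarith)] at h3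

/-- An integrable majorant of `g x * g y * |x - y| ^ α` and of its grid approximations. -/
noncomputable def singularMajorant (C α : ℝ) (p : ℝ × ℝ) : ℝ :=
  C * ((Set.Icc (-2 : ℝ) 2).indicator (fun _ => (1 : ℝ)) p.2 *
    (Set.Icc (-4 : ℝ) 4).indicator (fun u => |u| ^ α) (p.1 - p.2))

lemma integrable_singularMajorant (C : ℝ) {α : ℝ} (hα : -1 < α) :
    Integrable (singularMajorant C α) := by
  have h1 : Integrable ((Set.Icc (-2 : ℝ) 2).indicator fun _ => (1 : ℝ)) :=
    (integrable_indicator_iff measurableSet_Icc).2 (integrableOn_const (by simp))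
  have h2 := integrable_indicator_abs_rpow hα (r := 4) (by norm_num)
  exact (Integrable.convolution_integrand (ContinuousLinearMap.mul ℝ ℝ) h1 h2).const_mul C

lemma singularMajorant_nonneg {C : ℝ} (hC : 0 ≤ C) (α : ℝ) (p : ℝ × ℝ) :
    0 ≤ singularMajorant C α p := by
  refine mul_nonneg hC (mul_nonneg ?_ ?_)
  · exact Set.indicator_nonneg (fun _ _ => zero_le_one) _
  · exact Set.indicator_nonneg (fun _ _ => by positivity) _

lemma norm_mul_rpow_le_singularMajorant {α M : ℝ} (hα : α < 0) (hM : 0 ≤ M) {g : ℝ → ℝ}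
    (hg0 : ∀ x : ℝ, x ∉ Set.Icc (-1 : ℝ) 1 → g x = 0) (hgM : ∀ x, |g x| ≤ M)
    {x y u v : ℝ} (hxu : |x - u| ≤ 1) (hyv : |y - v| ≤ 1)
    (huv : u ≠ v → x ≠ y → |x - y| ≤ 2 * |u - v|) (hxy : x ≠ y) :
    ‖g u * g v * |u - v| ^ α‖ ≤ singularMajorant (M * M * 2 ^ (-α)) α (x, y) := by
  have hC : 0 ≤ M * M * (2 : ℝ) ^ (-α) := by positivity
  by_cases hu : u ∈ Set.Icc (-1 : ℝ) 1
  swap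
  · simpa [hg0 u hu] using singularMajorant_nonneg hC α (x, y)
  by_cases hv : v ∈ Set.Icc (-1 : ℝ) 1
  swap
  · simpa [hg0 v hv] using singularMajorant_nonneg hC α (x, y)
  by_cases hne : u = v
  · simpa [hne, Real.zero_rpow hα.ne] using singularMajorant_nonneg hC α (x, y)
  rw [abs_le] at hxu hyv
  have hy : y ∈ Set.Icc (-2 : ℝ) 2 := ⟨by linarith [hv.1], by linarith [hv.2]⟩
  have hd : x - y ∈ Set.Icc (-4 : ℝ) 4 :=
    ⟨by linarith [hu.1, hv.2], by linarith [hu.2, hv.1]⟩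
  have hle := huv hne hxy
  have hpos : 0 < |x - y| := abs_pos.2 (sub_ne_zero.2 hxy)
  have hrp : |u - v| ^ α ≤ 2 ^ (-α) * |x - y| ^ α := by
    have h1 : (2 * |u - v|) ^ α ≤ |x - y| ^ α := Real.rpow_le_rpow_of_nonpos hpos hle hα.le
    rw [Real.mul_rpow (by norm_num) (abs_nonneg _)] at h1
    calc |u - v| ^ α = 2 ^ (-α) * (2 ^ α * |u - v| ^ α) := by
          rw [← mul_assoc, ← Real.rpow_add (by norm_num)]; simp
      _ ≤ _ := by gcongr
  have hmaj : singularMajorant (M * M * 2 ^ (-α)) α (x, y) =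
      M * M * (2 ^ (-α) * |x - y| ^ α) := by
    simp only [singularMajorant, Set.indicator_of_mem hy, Set.indicator_of_mem hd]
    ring
  rw [hmaj, norm_mul, norm_mul, Real.norm_of_nonneg (by positivity : 0 ≤ |u - v| ^ α)]
  have := hgM u
  have := hgM v
  simp only [Real.norm_eq_abs]
  gcongr

lemma ae_prod_fst_ne (c : ℝ) : ∀ᵐ p : ℝ × ℝ, p.1 ≠ c :=
  Measure.quasiMeasurePreserving_fst.ae (Measure.ae_ne volume c)

lemma ae_prod_snd_ne (c : ℝ) : ∀ᵐ p : ℝ × ℝ, p.2 ≠ c :=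
  Measure.quasiMeasurePreserving_snd.ae (Measure.ae_ne volume c)

lemma ae_prod_fst_ne_snd : ∀ᵐ p : ℝ × ℝ, p.1 ≠ p.2 := by
  have hm : MeasurableSet {p : ℝ × ℝ | p.1 ≠ p.2} :=
    (measurableSet_eq_fun measurable_fst measurable_snd).compl
  rw [Measure.volume_eq_prod, Measure.ae_prod_iff_ae_ae hm]
  exact Eventually.of_forall fun x => (Measure.ae_ne volume x).mono fun y hy => hy.symm

section

variable {g : ℝ → ℝ}

lemma measurable_of_continuousOn_Icc_of_eq_zero (hg : ContinuousOn g (Set.Icc (-1 : ℝ) 1))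
    (hg0 : ∀ x : ℝ, x ∉ Set.Icc (-1 : ℝ) 1 → g x = 0) : Measurable g := by
  classical
  have h := hg.measurable_piecewise (g := fun _ => (0 : ℝ)) continuousOn_const measurableSet_Icc
  convert h using 1
  ext x
  by_cases hx : x ∈ Set.Icc (-1 : ℝ) 1
  · simp only [Set.piecewise_eq_of_mem _ _ _ hx]
  · simp only [Set.piecewise_eq_of_notMem _ _ _ hx, hg0 x hx]

lemma exists_forall_abs_le_of_continuousOn_Icc (hg : ContinuousOn g (Set.Icc (-1 : ℝ) 1))
    (hg0 : ∀ x : ℝ, x ∉ Set.Icc (-1 : ℝ) 1 → g x = 0) : ∃ M, 0 ≤ M ∧ ∀ x, |g x| ≤ M := by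
  obtain ⟨M, hM⟩ := isCompact_Icc.exists_bound_of_continuousOn hg
  refine ⟨M, (norm_nonneg _).trans (hM 0 (by simp)), fun x => ?_⟩
  by_cases hx : x ∈ Set.Icc (-1 : ℝ) 1
  · exact hM x hx
  · rw [hg0 x hx, abs_zero]
    exact (norm_nonneg _).trans (hM 0 (by simp))

lemma continuousAt_of_continuousOn_Icc (hg : ContinuousOn g (Set.Icc (-1 : ℝ) 1))
    (hg0 : ∀ x : ℝ, x ∉ Set.Icc (-1 : ℝ) 1 → g x = 0) {x : ℝ} (h1 : x ≠ -1) (h2 : x ≠ 1) :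
    ContinuousAt g x := by
  by_cases hx : x ∈ Set.Icc (-1 : ℝ) 1
  · exact hg.continuousAt (Icc_mem_nhds (lt_of_le_of_ne hx.1 h1.symm) (lt_of_le_of_ne hx.2 h2))
  · have : g =ᶠ[nhds x] fun _ => 0 := by
      filter_upwards [isClosed_Icc.isOpen_compl.mem_nhds hx] with y hy using hg0 y hy
    exact continuousAt_const.congr this.symm

lemma measurable_mul_mul_abs_sub_rpow (hg : Measurable g) (α : ℝ) :
    Measurable fun p : ℝ × ℝ => g p.1 * g p.2 * |p.1 - p.2| ^ α := by
  have h : Measurable fun p : ℝ × ℝ => |p.1 - p.2| :=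
    continuous_abs.measurable.comp (measurable_fst.sub measurable_snd)
  exact ((hg.comp measurable_fst).mul (hg.comp measurable_snd)).mul (h.pow_const α)

lemma intervalIntegral_intervalIntegral_eq_integral_prod {α : ℝ} (hα : α ∈ Set.Ioo (-1 : ℝ) 0)
    (hg : ContinuousOn g (Set.Icc (-1 : ℝ) 1))
    (hg0 : ∀ x : ℝ, x ∉ Set.Icc (-1 : ℝ) 1 → g x = 0) :
    ∫ x in (-1 : ℝ)..1, ∫ y in (-1 : ℝ)..1, g x * g y * |x - y| ^ α =
      ∫ p : ℝ × ℝ, g p.1 * g p.2 * |p.1 - p.2| ^ α := by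
  obtain ⟨M, hM0, hM⟩ := exists_forall_abs_le_of_continuousOn_Icc hg hg0
  have hm := measurable_mul_mul_abs_sub_rpow (measurable_of_continuousOn_Icc_of_eq_zero hg hg0) α
  have hint : Integrable fun p : ℝ × ℝ => g p.1 * g p.2 * |p.1 - p.2| ^ α := by
    refine (integrable_singularMajorant (M * M * 2 ^ (-α)) hα.1).mono' hm.aestronglyMeasurable ?_
    filter_upwards [ae_prod_fst_ne_snd] with p hp
    refine norm_mul_rpow_le_singularMajorant hα.2 hM0 hg0 hM (by simp) (by simp) ?_ hp
    intro _ _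
    linarith [abs_nonneg (p.1 - p.2)]
  have key (f : ℝ → ℝ) (hf : ∀ x : ℝ, x ∉ Set.Icc (-1 : ℝ) 1 → f x = 0) :
      ∫ x in (-1 : ℝ)..1, f x = ∫ x, f x := by
    rw [intervalIntegral.integral_of_le (by norm_num), ← integral_Icc_eq_integral_Ioc,
      setIntegral_eq_integral_of_forall_compl_eq_zero hf]
  rw [Measure.volume_eq_prod, integral_prod _ hint, key]
  · refine integral_congr_ae (Eventually.of_forall fun x => ?_)
    exact key _ fun y hy => by simp [hg0 y hy]
  · intro x hx
    simp [hg0 x hx]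

lemma tendsto_integral_gridCeil {α : ℝ} (hα : α ∈ Set.Ioo (-1 : ℝ) 0)
    (hg : ContinuousOn g (Set.Icc (-1 : ℝ) 1))
    (hg0 : ∀ x : ℝ, x ∉ Set.Icc (-1 : ℝ) 1 → g x = 0)
    {ι : Type*} {l : Filter ι} [l.IsCountablyGenerated] {h s : ι → ℝ}
    (hpos : ∀ᶠ i in l, 0 < h i) (h0 : Tendsto h l (nhds 0)) :
    Tendsto (fun i => ∫ p : ℝ × ℝ, g (gridCeil (h i) (s i) p.1) * g (gridCeil (h i) (s i) p.2) *
        |gridCeil (h i) (s i) p.1 - gridCeil (h i) (s i) p.2| ^ α) l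
      (nhds (∫ p : ℝ × ℝ, g p.1 * g p.2 * |p.1 - p.2| ^ α)) := by
  obtain ⟨M, hM0, hM⟩ := exists_forall_abs_le_of_continuousOn_Icc hg hg0
  have hm := measurable_mul_mul_abs_sub_rpow (measurable_of_continuousOn_Icc_of_eq_zero hg hg0) α
  refine tendsto_integral_filter_of_dominated_convergence (singularMajorant (M * M * 2 ^ (-α)) α)
    (Eventually.of_forall fun i => ?_) ?_ (integrable_singularMajorant _ hα.1) ?_
  · have hc : Measurable (gridCeil (h i) (s i)) := by
      unfold gridCeil
      fun_prop
    exact (hm.comp ((hc.comp measurable_fst).prodMk (hc.comp measurable_snd))).aestronglyMeasurable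
  · filter_upwards [hpos, h0.eventually_le_const zero_lt_one] with i hi hi1
    filter_upwards [ae_prod_fst_ne_snd] with p hp
    have hnear (x : ℝ) : |x - gridCeil (h i) (s i) x| ≤ 1 := by
      have h1 := le_gridCeil hi (s i) x
      have h2 := gridCeil_lt_add hi (s i) x
      rw [abs_le]
      constructor <;> linarith
    exact norm_mul_rpow_le_singularMajorant hα.2 hM0 hg0 hM (hnear _) (hnear _)
      (fun hne _ => abs_sub_le_two_mul_abs_gridCeil_sub hi hne) hp
  · filter_upwards [ae_prod_fst_ne_snd, ae_prod_fst_ne (-1), ae_prod_fst_ne 1, ae_prod_snd_ne (-1),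
      ae_prod_snd_ne 1] with p hp h1 h2 h3 h4
    have hx := tendsto_gridCeil (s := s) hpos h0 p.1
    have hy := tendsto_gridCeil (s := s) hpos h0 p.2
    exact (((continuousAt_of_continuousOn_Icc hg hg0 h1 h2).tendsto.comp hx).mul
      ((continuousAt_of_continuousOn_Icc hg hg0 h3 h4).tendsto.comp hy)).mul
      ((hx.sub hy).abs.rpow_const (Or.inl (abs_ne_zero.2 (sub_ne_zero.2 hp))))

lemma integral_gridCeil_eq_sum {α : ℝ} (hα : α ≠ 0)
    (hg0 : ∀ x : ℝ, x ∉ Set.Icc (-1 : ℝ) 1 → g x = 0)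
    {N : ℕ} {b t : ℝ} (hN : 0 < N) (hb : 0 < b) (hbt : b < t) (hbt' : b < 1 - t) :
    ∫ p : ℝ × ℝ, g (gridCeil ((N : ℝ) * b)⁻¹ (t / b) p.1) * g (gridCeil ((N : ℝ) * b)⁻¹ (t / b) p.2) *
        |gridCeil ((N : ℝ) * b)⁻¹ (t / b) p.1 - gridCeil ((N : ℝ) * b)⁻¹ (t / b) p.2| ^ α =
      (((N : ℝ) * b) ^ 2)⁻¹ *
        ∑ j₁ ∈ Finset.Icc 1 N, ∑ j₂ ∈ Finset.Icc 1 N,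
          if j₁ ≠ j₂ then
            g (((j₁ : ℝ) / (N : ℝ) - t) / b) * g (((j₂ : ℝ) / (N : ℝ) - t) / b) *
              (|(j₁ : ℝ) - (j₂ : ℝ)| / ((N : ℝ) * b)) ^ α
          else 0 := by
  have hN' : (0 : ℝ) < N := by exact_mod_cast hN
  have hNb : 0 < (N : ℝ) * b := mul_pos hN' hb
  set q : ℤ → ℝ := fun i => ((N : ℝ) * b)⁻¹ * i - t / b with hq
  have hq_eq (i : ℤ) : q i = ((i : ℝ) / N - t) / b := by
    simp only [hq]; field_simp
  have hsupp (i : ℤ) (hi : i ∉ (Finset.Icc 1 N).map Nat.castEmbedding) : g (q i) = 0 := by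
    apply hg0
    rintro ⟨h1, h2⟩
    rw [hq_eq, le_div_iff₀ hb] at h1
    rw [hq_eq, div_le_iff₀ hb] at h2
    have hi0 : (0 : ℝ) < i := by
      have : 0 < (i : ℝ) / N := by linarith
      simpa [hN'] using (div_pos_iff_of_pos_right hN').1 this
    have hiN : (i : ℝ) < N := by
      have : (i : ℝ) / N < 1 := by linarith
      simpa using (div_lt_one hN').1 this
    have hi0' : 0 < i := by exact_mod_cast hi0
    have hiN' : i < N := by exact_mod_cast hiN
    apply hi
    rw [Finset.mem_map]
    refine ⟨i.toNat, Finset.mem_Icc.2 ⟨by omega, by omega⟩, ?_⟩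
    simp only [Nat.castEmbedding_apply]
    omega
  have hmain := integral_comp_ceil_prod (inv_pos.2 hNb) (t / b)
    (fun i j => g (q i) * g (q j) * |q i - q j| ^ α)
    ((Finset.Icc 1 N).map Nat.castEmbedding) (by
      intro i j hij
      by_cases hi : i ∈ (Finset.Icc 1 N).map Nat.castEmbedding
      · simp only [hsupp j fun hj => hij ⟨hi, hj⟩, mul_zero, zero_mul]
      · simp only [hsupp i hi, zero_mul])
  refine hmain.trans ?_
  rw [inv_pow, Finset.sum_map]
  congr 1
  refine Finset.sum_congr rfl fun i _ => ?_
  rw [Finset.sum_map]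
  refine Finset.sum_congr rfl fun j _ => ?_
  simp only [Nat.castEmbedding_apply]
  split_ifs with hij
  · have hd : |q i - q j| = |(i : ℝ) - j| / ((N : ℝ) * b) := by
      have h1 : q i - q j = ((i : ℝ) - j) / ((N : ℝ) * b) := by
        simp only [hq, Int.cast_natCast]
        field_simp
        ring
      rw [h1, abs_div, abs_of_pos hNb]
    rw [hd, hq_eq, hq_eq]
    simp only [Int.cast_natCast]
  · rw [not_not.1 hij]
    simp [Real.zero_rpow hα]

end

/-- Deterministic core of the long-range-dependence variance term: for
`α ∈ (-1,0)`, `g` continuous on `[-1,1]` and zero outside, `t ∈ (0,1)`, the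
normalized singular double Riemann sum converges to `∬ g(x)g(y)|x-y|^α dx dy`. -/
theorem stmt_13 (α : ℝ) (hα : α ∈ Set.Ioo (-1 : ℝ) 0)
    (g : ℝ → ℝ) (hg : ContinuousOn g (Set.Icc (-1 : ℝ) 1))
    (hg0 : ∀ x : ℝ, x ∉ Set.Icc (-1 : ℝ) 1 → g x = 0)
    (t : ℝ) (ht : t ∈ Set.Ioo (0 : ℝ) 1)
    (N : ℕ → ℕ) (b : ℕ → ℝ) (hbpos : ∀ m, 0 < b m)
    (hN : Tendsto N atTop atTop) (hb0 : Tendsto b atTop (nhds 0))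
    (hNb : Tendsto (fun m => (N m : ℝ) * b m) atTop atTop) :
    Tendsto
      (fun m =>
        (((N m : ℝ) * b m) ^ 2)⁻¹ *
          ∑ j₁ ∈ Finset.Icc 1 (N m), ∑ j₂ ∈ Finset.Icc 1 (N m),
            if j₁ ≠ j₂ then
              g (((j₁ : ℝ) / (N m : ℝ) - t) / b m) * g (((j₂ : ℝ) / (N m : ℝ) - t) / b m) *
                (|(j₁ : ℝ) - (j₂ : ℝ)| / ((N m : ℝ) * b m)) ^ α
            else 0)
      atTop
      (nhds (∫ x in (-1 : ℝ)..1, ∫ y in (-1 : ℝ)..1, g x * g y * |x - y| ^ α)) := by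
  rw [intervalIntegral_intervalIntegral_eq_integral_prod hα hg hg0]
  have hpos : ∀ᶠ m in atTop, 0 < ((N m : ℝ) * b m)⁻¹ :=
    (hNb.eventually_gt_atTop 0).mono fun m hm => inv_pos.2 hm
  refine (tendsto_integral_gridCeil hα hg hg0 (s := fun m => t / b m) hpos
    (tendsto_inv_atTop_zero.comp hNb)).congr' ?_
  filter_upwards [hN.eventually_gt_atTop 0, hb0.eventually_lt_const ht.1,
    hb0.eventually_lt_const (sub_pos.2 ht.2)] with m h1 h2 h3
  exact integral_gridCeil_eq_sum hα.2.ne hg0 h1 (hbpos m) h2 h3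
end

section
/- Let v ≤ k − 2 be natural numbers, φ : [0,1] → ℝ k-times continuously differentiable, and K : ℝ → ℝ (v+1)-times continuously differentiable on [−1,1], zero outside [−1,1], with K^{(i)}(−1) = K^{(i)}(1) = 0 for i = 0,…,v−1 and K^{(v)} of order (v,k). Fix δ ∈ (0, 1/2). Then there exist constants C, C′ (depending only on K, φ, v, k, δ) such that for every b ∈ (0, δ) and every partition 0 = t_0 < t_1 < … < t_N = 1 with spacings t_j − t_{j−1} ≤ β^{−1} ≤ b: sup_{t ∈ [δ, 1−δ]} | (−1)^v b^{−(v+1)} Σ_{j=1}^{N} (t_j − t_{j−1}) K^{(v)}((t_j − t)/b) φ(t_j) − φ^{(v)}(t) | ≤ C b^{k−v} + C′ (b^{v+1} β)^{−1}. -/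
open MeasureTheory Set Finset

/-- Taylor's theorem with a polynomial remainder bound that is uniform in the expansion point. -/
theorem exists_uniform_taylor_remainder_bound {f : ℝ → ℝ} {a b : ℝ} {n : ℕ} (hab : a < b)
    (hf : ContDiffOn ℝ (n + 1) f (Set.Icc a b)) :
    ∃ C : ℝ, 0 ≤ C ∧ ∀ t ∈ Set.Icc a b, ∀ x ∈ Set.Icc a b,
      |f x - taylorWithinEval f n (Set.Icc a b) t x| ≤ C * |x - t| ^ (n + 1) := by
  have hu := uniqueDiffOn_Icc hab
  obtain ⟨M, hM⟩ := isCompact_Icc.exists_bound_of_continuousOn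
    (hf.continuousOn_iteratedDerivWithin (m := n + 1) (by norm_cast) hu)
  have hM0 : 0 ≤ M := (norm_nonneg _).trans (hM a (left_mem_Icc.2 hab.le))
  refine ⟨M, hM0, fun t ht x hx => ?_⟩
  have hsub : uIcc t x ⊆ Set.Icc a b := ordConnected_Icc.uIcc_subset ht hx
  have hder : ∀ y ∈ uIcc t x, HasDerivWithinAt
      (fun y => taylorWithinEval f n (Set.Icc a b) y x)
      (((n.factorial : ℝ)⁻¹ * (x - y) ^ n) • iteratedDerivWithin (n + 1) f (Set.Icc a b) y)
      (uIcc t x) y := fun y hy =>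
    (hasDerivWithinAt_taylorWithinEval_at_Icc x hab (hsub hy) hf.of_succ
      (hf.differentiableOn_iteratedDerivWithin (mod_cast n.lt_succ_self) hu)).mono hsub
  have hbound : ∀ y ∈ uIcc t x,
      ‖((n.factorial : ℝ)⁻¹ * (x - y) ^ n) • iteratedDerivWithin (n + 1) f (Set.Icc a b) y‖ ≤
        |x - t| ^ n * M := by
    intro y hy
    rw [norm_smul, norm_mul, norm_pow, norm_inv, Real.norm_natCast, Real.norm_eq_abs]
    have h1 : |x - y| ≤ |x - t| := abs_sub_right_of_mem_uIcc hy
    have h2 : ((n.factorial : ℝ))⁻¹ ≤ 1 := inv_le_one_of_one_le₀ (mod_cast n.factorial_pos)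
    have h3 : (n.factorial : ℝ)⁻¹ * |x - y| ^ n ≤ 1 * |x - t| ^ n := by gcongr
    rw [one_mul] at h3
    exact mul_le_mul h3 (hM y (hsub hy)) (norm_nonneg _) (by positivity)
  have := (convex_uIcc t x).norm_image_sub_le_of_norm_hasDerivWithin_le hder hbound
    left_mem_uIcc right_mem_uIcc
  simp only [taylorWithinEval_self, Real.norm_eq_abs] at this
  calc _ ≤ _ := this
    _ = _ := by ring

/-- A function with continuous derivative on a compact interval is Lipschitz there. -/
theorem exists_abs_sub_le_of_continuousOn_derivWithin {f : ℝ → ℝ} {a b : ℝ}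
    (hf : DifferentiableOn ℝ f (Set.Icc a b))
    (hf' : ContinuousOn (derivWithin f (Set.Icc a b)) (Set.Icc a b)) :
    ∃ L : ℝ, 0 ≤ L ∧ ∀ x ∈ Set.Icc a b, ∀ y ∈ Set.Icc a b, |f y - f x| ≤ L * |y - x| := by
  obtain ⟨L, hL⟩ := isCompact_Icc.exists_bound_of_continuousOn hf'
  refine ⟨|L|, abs_nonneg _, fun x hx y hy => ?_⟩
  exact (convex_Icc a b).norm_image_sub_le_of_norm_derivWithin_le hf
    (fun z hz => (hL z hz).trans (le_abs_self L)) hx hy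

/-- The increments of a function that is Lipschitz on an interval and vanishes outside of it are
dominated by those of a bounded function. -/
theorem exists_increment_bound_of_lipschitz_of_support {f : ℝ → ℝ} {L M : ℝ} (hL : 0 ≤ L)
    (hlip : ∀ x ∈ Set.Icc (-1 : ℝ) 1, ∀ y ∈ Set.Icc (-1 : ℝ) 1, |f y - f x| ≤ L * |y - x|)
    (hM : ∀ x, |f x| ≤ M) (hsupp : ∀ x ∉ Set.Icc (-1 : ℝ) 1, f x = 0) :
    ∃ G : ℝ → ℝ, (∀ x y, x ≤ y → |f y - f x| ≤ G y - G x) ∧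
      ∀ x y, G y - G x ≤ 2 * L + 2 * M := by
  have hM0 : 0 ≤ M := (abs_nonneg _).trans (hM 0)
  let c : ℝ → ℝ := fun u => max (-1) (min u 1)
  have hc : ∀ u, -1 ≤ c u ∧ c u ≤ 1 := fun u => by grind
  have hcm : ∀ x y, x ≤ y → L * c x ≤ L * c y := fun x y h =>
    mul_le_mul_of_nonneg_left (by grind) hL
  refine ⟨fun u => L * c u + (if -1 ≤ u then M else 0) + (if 1 < u then M else 0), ?_, ?_⟩
  · intro x y hxy
    have h0 := hcm x y hxy
    by_cases hx : x ∈ Set.Icc (-1 : ℝ) 1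
    · by_cases hy : y ∈ Set.Icc (-1 : ℝ) 1
      · have h1 := hlip x hx y hy
        have hcx : c x = x := by grind
        have hcy : c y = y := by grind
        rw [abs_of_nonneg (sub_nonneg.2 hxy)] at h1
        simp only [hcx, hcy, if_pos hx.1, if_pos hy.1, if_neg hx.2.not_gt, if_neg hy.2.not_gt]
        linarith
      · have h1 := hM x
        rw [hsupp y hy, zero_sub, abs_neg]
        grind
    · by_cases hy : y ∈ Set.Icc (-1 : ℝ) 1
      · have h1 := hM y
        rw [hsupp x hx, sub_zero]
        grind
      · rw [hsupp x hx, hsupp y hy, sub_zero, abs_zero]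
        grind
  · intro x y
    have h1 : L * c y ≤ L * 1 := mul_le_mul_of_nonneg_left (hc y).2 hL
    have h2 : L * (-1) ≤ L * c x := mul_le_mul_of_nonneg_left (hc x).1 hL
    grind

/-- A function whose increments are dominated by those of another one is interval integrable. -/
theorem intervalIntegrable_of_increment_le {f H : ℝ → ℝ} {a b : ℝ} (hab : a ≤ b)
    (hfH : ∀ x ∈ Set.Icc a b, ∀ y ∈ Set.Icc a b, x ≤ y → |f y - f x| ≤ H y - H x) :
    IntervalIntegrable f volume a b := by
  have h1 : MonotoneOn H (uIcc a b) := by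
    rw [uIcc_of_le hab]
    intro x hx y hy hxy
    linarith [hfH x hx y hy hxy, abs_nonneg (f y - f x)]
  have h2 : MonotoneOn (fun x => H x - f x) (uIcc a b) := by
    rw [uIcc_of_le hab]
    intro x hx y hy hxy
    have := (le_abs_self _).trans (hfH x hx y hy hxy)
    change H x - f x ≤ H y - f y
    linarith
  simpa using h1.intervalIntegrable.sub h2.intervalIntegrable

/-- The error of a right-endpoint Riemann sum is at most the mesh times a bound for the
variation. -/
theorem abs_riemann_sum_sub_integral_le {f H : ℝ → ℝ} {tp : ℕ → ℝ} {N : ℕ} {h : ℝ}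
    (hmono : ∀ j < N, tp j ≤ tp (j + 1)) (hmesh : ∀ j < N, tp (j + 1) - tp j ≤ h)
    (hfH : ∀ x ∈ Set.Icc (tp 0) (tp N), ∀ y ∈ Set.Icc (tp 0) (tp N), x ≤ y →
      |f y - f x| ≤ H y - H x) :
    |∑ j ∈ Finset.range N, (tp (j + 1) - tp j) * f (tp (j + 1)) - ∫ x in tp 0..tp N, f x| ≤
      h * (H (tp N) - H (tp 0)) := by
  have hle : ∀ i j, i ≤ j → j ≤ N → tp i ≤ tp j := by
    intro i j hij
    induction j, hij using Nat.le_induction with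
    | base => exact fun _ => le_rfl
    | succ j _ ih => exact fun hj => (ih (by omega)).trans (hmono j (by omega))
  have hsub : ∀ j < N, Set.Icc (tp j) (tp (j + 1)) ⊆ Set.Icc (tp 0) (tp N) := fun j hj =>
    Set.Icc_subset_Icc (hle 0 j (by omega) hj.le) (hle (j + 1) N hj le_rfl)
  have hfj : ∀ j < N, ∀ x ∈ Set.Icc (tp j) (tp (j + 1)), ∀ y ∈ Set.Icc (tp j) (tp (j + 1)),
      x ≤ y → |f y - f x| ≤ H y - H x := fun j hj x hx y hy =>
    hfH x (hsub j hj hx) y (hsub j hj hy)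
  have hint : ∀ j < N, IntervalIntegrable f volume (tp j) (tp (j + 1)) := fun j hj =>
    intervalIntegrable_of_increment_le (hmono j hj) (hfj j hj)
  rw [← intervalIntegral.sum_integral_adjacent_intervals hint, ← Finset.sum_sub_distrib,
    ← Finset.sum_range_sub (fun j => H (tp j)), Finset.mul_sum]
  refine (Finset.abs_sum_le_sum_abs _ _).trans (Finset.sum_le_sum fun j hj => ?_)
  have hj := Finset.mem_range.1 hj
  have hm := hmono j hj
  have hH : ∀ x ∈ Set.Icc (tp j) (tp (j + 1)),
      |f (tp (j + 1)) - f x| ≤ H (tp (j + 1)) - H (tp j) := by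
    intro x hx
    have h1 := hfj j hj x hx _ (right_mem_Icc.2 hm) hx.2
    have h2 := hfj j hj _ (left_mem_Icc.2 hm) x hx hx.1
    linarith [abs_nonneg (f x - f (tp j))]
  have heq : (tp (j + 1) - tp j) * f (tp (j + 1)) - ∫ x in tp j..tp (j + 1), f x =
      ∫ x in tp j..tp (j + 1), (f (tp (j + 1)) - f x) := by
    rw [intervalIntegral.integral_sub intervalIntegrable_const (hint j hj),
      intervalIntegral.integral_const, smul_eq_mul]
  have hnorm : ‖∫ x in tp j..tp (j + 1), (f (tp (j + 1)) - f x)‖ ≤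
      (H (tp (j + 1)) - H (tp j)) * |tp (j + 1) - tp j| :=
    intervalIntegral.norm_integral_le_of_norm_le_const fun x hx => by
      rw [uIoc_of_le hm] at hx
      exact hH x (Ioc_subset_Icc_self hx)
  rw [heq]
  refine hnorm.trans ?_
  rw [abs_of_nonneg (sub_nonneg.2 hm), mul_comm]
  exact mul_le_mul_of_nonneg_right (hmesh j hj)
    ((abs_nonneg _).trans (hH _ (left_mem_Icc.2 hm)))

/-- The integral of a rescaled compactly supported kernel against a function. -/
theorem integral_rescaled_kernel_mul {g φ : ℝ → ℝ} (hsupp : ∀ x ∉ Set.Icc (-1 : ℝ) 1, g x = 0)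
    {b t : ℝ} (hb : 0 < b) (h0 : 0 ≤ t - b) (h1 : t + b ≤ 1) :
    ∫ x in (0 : ℝ)..1, g ((x - t) / b) * φ x = b * ∫ u in (-1 : ℝ)..1, g u * φ (t + b * u) := by
  have hsc := intervalIntegral.integral_comp_add_mul (a := -1) (b := 1)
    (fun x => g ((x - t) / b) * φ x) hb.ne' t
  have hcancel : ∀ u : ℝ, (t + b * u - t) / b = u := fun u => by field_simp; ring
  simp only [hcancel] at hsc
  rw [hsc, smul_eq_mul, ← mul_assoc, mul_inv_cancel₀ hb.ne', one_mul,
    intervalIntegral.integral_of_le zero_le_one, intervalIntegral.integral_of_le (by linarith),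
    ← integral_Icc_eq_integral_Ioc, ← integral_Icc_eq_integral_Ioc]
  refine setIntegral_eq_of_subset_of_forall_sdiff_eq_zero measurableSet_Icc
    (Set.Icc_subset_Icc (by linarith) (by linarith)) (fun x hx => ?_)
  rw [hsupp, zero_mul]
  rintro ⟨hl, hr⟩
  rw [le_div_iff₀ hb] at hl
  rw [div_le_iff₀ hb] at hr
  exact hx.2 ⟨by linarith, by linarith⟩

/-- Bias of the rescaled integral of a function against a kernel of order `(v, n + 1)`. -/
theorem abs_integral_kernel_sub_iteratedDerivWithin_le {g φ : ℝ → ℝ} {v n : ℕ} (hv : v ≤ n)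
    (hg : ContinuousOn g (Set.Icc (-1) 1)) {M C : ℝ} (hM : ∀ u, |g u| ≤ M)
    (hordv : ∫ x in (-1 : ℝ)..1, x ^ v * g x = (-1 : ℝ) ^ v * (v.factorial : ℝ))
    (hord0 : ∀ j ≤ n, j ≠ v → ∫ x in (-1 : ℝ)..1, x ^ j * g x = 0)
    (hφ : ContinuousOn φ (Set.Icc 0 1)) {b t : ℝ} (hb : 0 < b) (hC0 : 0 ≤ C)
    (h0 : 0 ≤ t - b) (h1 : t + b ≤ 1)
    (hC : ∀ x ∈ Set.Icc (0 : ℝ) 1,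
      |φ x - taylorWithinEval φ n (Set.Icc 0 1) t x| ≤ C * |x - t| ^ (n + 1)) :
    |(∫ u in (-1 : ℝ)..1, g u * φ (t + b * u)) -
      (-1) ^ v * b ^ v * iteratedDerivWithin v φ (Set.Icc 0 1) t| ≤
        2 * M * C * b ^ (n + 1) := by
  set D : ℕ → ℝ := fun j => iteratedDerivWithin j φ (Set.Icc 0 1) t with hD
  have hM0 : 0 ≤ M := (abs_nonneg _).trans (hM 0)
  have hmem : ∀ u ∈ Set.Icc (-1 : ℝ) 1, t + b * u ∈ Set.Icc (0 : ℝ) 1 := fun u hu =>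
    ⟨by nlinarith [hu.1], by nlinarith [hu.2]⟩
  have huIcc : uIcc (-1 : ℝ) 1 = Set.Icc (-1) 1 := uIcc_of_le (by norm_num)
  have hintφ : IntervalIntegrable (fun u => g u * φ (t + b * u)) volume (-1) 1 := by
    refine ContinuousOn.intervalIntegrable ?_
    rw [huIcc]
    exact hg.mul (hφ.comp (by fun_prop) hmem)
  have hintj : ∀ j : ℕ, IntervalIntegrable (fun u => u ^ j * g u) volume (-1) 1 := fun j => by
    refine ContinuousOn.intervalIntegrable ?_
    rw [huIcc]
    exact (by fun_prop : ContinuousOn (fun u : ℝ => u ^ j) _).mul hg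
  have hT : ∀ u, g u * taylorWithinEval φ n (Set.Icc 0 1) t (t + b * u) =
      ∑ j ∈ Finset.range (n + 1), ((j.factorial : ℝ)⁻¹ * b ^ j * D j) * (u ^ j * g u) := by
    intro u
    rw [taylor_within_apply, Finset.mul_sum]
    refine Finset.sum_congr rfl fun j _ => ?_
    simp only [smul_eq_mul, add_sub_cancel_left, mul_pow, hD]
    ring
  have hintT : IntervalIntegrable
      (fun u => g u * taylorWithinEval φ n (Set.Icc 0 1) t (t + b * u)) volume (-1) 1 := by
    simp only [hT]
    have := IntervalIntegrable.sum (Finset.range (n + 1)) fun j _ =>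
      (hintj j).const_mul ((j.factorial : ℝ)⁻¹ * b ^ j * D j)
    rwa [Finset.sum_fn] at this
  have hval : ∫ u in (-1 : ℝ)..1, g u * taylorWithinEval φ n (Set.Icc 0 1) t (t + b * u) =
      (-1) ^ v * b ^ v * D v := by
    simp only [hT]
    rw [intervalIntegral.integral_finsetSum fun j _ => (hintj j).const_mul _]
    simp only [intervalIntegral.integral_const_mul]
    rw [Finset.sum_eq_single v]
    · rw [hordv]
      have : (v.factorial : ℝ) ≠ 0 := mod_cast v.factorial_ne_zero
      field_simp
    · intro j hj hjv
      rw [hord0 j (by simpa [Nat.lt_succ_iff] using hj) hjv, mul_zero]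
    · intro h
      exact absurd (Finset.mem_range.2 (by omega)) h
  rw [← hval, ← intervalIntegral.integral_sub hintφ hintT]
  have hnorm := intervalIntegral.norm_integral_le_of_norm_le_const (a := -1) (b := 1)
    (C := M * (C * b ^ (n + 1)))
    (f := fun u => g u * φ (t + b * u) - g u * taylorWithinEval φ n (Set.Icc 0 1) t (t + b * u))
    (fun u hu => by
      rw [uIoc_of_le (by norm_num)] at hu
      have hu' := Ioc_subset_Icc_self hu
      rw [← mul_sub, norm_mul, Real.norm_eq_abs, Real.norm_eq_abs]
      refine mul_le_mul (hM u) ((hC _ (hmem u hu')).trans ?_) (abs_nonneg _) hM0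
      rw [add_sub_cancel_left, abs_mul, abs_of_pos hb]
      have : b * |u| ≤ b := mul_le_of_le_one_right hb.le (abs_le.2 hu')
      gcongr)
  rw [Real.norm_eq_abs] at hnorm
  refine hnorm.trans_eq ?_
  norm_num
  ring

/-- Uniform bias bound for the deterministic Priestley–Chao weight
`c_N(t) = (-1)^v b^{-(v+1)} Σ_j (t_j - t_{j-1}) K⁽ᵛ⁾((t_j - t)/b) φ(t_j)`:
there are constants `C, C'` (depending only on `K, φ, v, k, δ`) with
`sup_{t ∈ [δ,1-δ]} |c_N(t) - φ⁽ᵛ⁾(t)| ≤ C b^{k-v} + C' (b^{v+1} β)⁻¹`. -/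
theorem stmt_14 (v k : ℕ) (hvk : v + 2 ≤ k)
    (φ : ℝ → ℝ) (hφ : ContDiffOn ℝ k φ (Set.Icc (0 : ℝ) 1))
    (K Kv : ℝ → ℝ) (hK : ContDiffOn ℝ (v + 1) K (Set.Icc (-1 : ℝ) 1))
    (hKsupp : ∀ x : ℝ, x ∉ Set.Icc (-1 : ℝ) 1 → K x = 0)
    (hKbound : ∀ i < v, iteratedDerivWithin i K (Set.Icc (-1 : ℝ) 1) (-1) = 0 ∧
      iteratedDerivWithin i K (Set.Icc (-1 : ℝ) 1) 1 = 0)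
    (hKv : ∀ x : ℝ, Kv x =
      if x ∈ Set.Icc (-1 : ℝ) 1 then iteratedDerivWithin v K (Set.Icc (-1 : ℝ) 1) x else 0)
    -- `Kv = K⁽ᵛ⁾` is of order `(v,k)`
    (hordv : ∫ x in (-1 : ℝ)..1, x ^ v * Kv x = (-1 : ℝ) ^ v * (v.factorial : ℝ))
    (hord0 : ∀ j < k, j ≠ v → ∫ x in (-1 : ℝ)..1, x ^ j * Kv x = 0)
    (hordk : ∫ x in (-1 : ℝ)..1, x ^ k * Kv x ≠ 0)
    (δ : ℝ) (hδ : δ ∈ Set.Ioo (0 : ℝ) (1 / 2)) :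
    ∃ C C' : ℝ, ∀ b : ℝ, b ∈ Set.Ioo 0 δ → ∀ (N : ℕ) (tp : ℕ → ℝ) (β : ℝ),
      tp 0 = 0 → tp N = 1 → (∀ j < N, tp j < tp (j + 1)) →
      (∀ j < N, tp (j + 1) - tp j ≤ β⁻¹) → β⁻¹ ≤ b →
      ∀ t ∈ Set.Icc δ (1 - δ),
        |(-1 : ℝ) ^ v / b ^ (v + 1) *
            (∑ j ∈ Finset.range N, (tp (j + 1) - tp j) * Kv ((tp (j + 1) - t) / b) * φ (tp (j + 1))) -
          iteratedDerivWithin v φ (Set.Icc (0 : ℝ) 1) t| ≤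
        C * b ^ (k - v) + C' * (b ^ (v + 1) * β)⁻¹ := by
  obtain ⟨n, rfl⟩ : ∃ n, k = n + 1 := ⟨k - 1, by omega⟩
  have hu1 : UniqueDiffOn ℝ (Set.Icc (-1 : ℝ) 1) := uniqueDiffOn_Icc (by norm_num)
  have hu0 : UniqueDiffOn ℝ (Set.Icc (0 : ℝ) 1) := uniqueDiffOn_Icc zero_lt_one
  have hsupp : ∀ x ∉ Set.Icc (-1 : ℝ) 1, Kv x = 0 := fun x hx => by rw [hKv, if_neg hx]
  have hKeq : EqOn Kv (iteratedDerivWithin v K (Set.Icc (-1 : ℝ) 1)) (Set.Icc (-1 : ℝ) 1) :=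
    fun x hx => by rw [hKv, if_pos hx]
  have hKcont : ContinuousOn Kv (Set.Icc (-1 : ℝ) 1) :=
    (hK.continuousOn_iteratedDerivWithin (m := v) (mod_cast v.le_succ) hu1).congr hKeq
  have hφcont : ContinuousOn φ (Set.Icc 0 1) := hφ.continuousOn
  obtain ⟨M, hM'⟩ := isCompact_Icc.exists_bound_of_continuousOn hKcont
  have hM : ∀ x, |Kv x| ≤ M := by
    intro x
    by_cases hx : x ∈ Set.Icc (-1 : ℝ) 1
    · exact hM' x hx
    · rw [hsupp x hx, abs_zero]
      exact (norm_nonneg _).trans (hM' 0 (by norm_num))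
  have hM0 : 0 ≤ M := (abs_nonneg _).trans (hM 0)
  obtain ⟨P, hP⟩ := isCompact_Icc.exists_bound_of_continuousOn hφcont
  have hP0 : 0 ≤ P := (norm_nonneg _).trans (hP 0 (by norm_num))
  obtain ⟨L, hL0, hL⟩ := exists_abs_sub_le_of_continuousOn_derivWithin
    (hK.differentiableOn_iteratedDerivWithin (m := v) (mod_cast v.lt_succ_self) hu1)
    ((hK.continuousOn_iteratedDerivWithin (m := v + 1) (by norm_cast) hu1).congr
      fun x _ => congrFun iteratedDerivWithin_succ.symm x)
  obtain ⟨Q, hQ0, hQ⟩ := exists_abs_sub_le_of_continuousOn_derivWithin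
    (hφ.differentiableOn (by simp))
    (hφ.continuousOn_derivWithin hu0 (by simp))
  obtain ⟨G, hG, hGV⟩ := exists_increment_bound_of_lipschitz_of_support hL0
    (fun x hx y hy => by rw [hKeq hx, hKeq hy]; exact hL x hx y hy) hM hsupp
  obtain ⟨A, hA0, hA⟩ := exists_uniform_taylor_remainder_bound (n := n) zero_lt_one
    (by exact_mod_cast hφ)
  refine ⟨2 * M * A, P * (2 * L + 2 * M) + M * Q, ?_⟩
  rintro b ⟨hb, hbδ⟩ N tp β htp0 htpN hmono hmesh - t ⟨ht0, ht1⟩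
  have hδ1 := hδ.2
  have hβ : 0 ≤ β⁻¹ := by
    have hN : 0 < N := Nat.pos_of_ne_zero fun h => by
      subst h
      linarith
    linarith [hmono 0 hN, hmesh 0 hN]
  set S := ∑ j ∈ Finset.range N,
    (tp (j + 1) - tp j) * Kv ((tp (j + 1) - t) / b) * φ (tp (j + 1))
  set D := iteratedDerivWithin v φ (Set.Icc (0 : ℝ) 1) t
  let H : ℝ → ℝ := fun x => P * G ((x - t) / b) + M * Q * x
  have hH : ∀ x ∈ Set.Icc (0 : ℝ) 1, ∀ y ∈ Set.Icc (0 : ℝ) 1, x ≤ y →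
      |Kv ((y - t) / b) * φ y - Kv ((x - t) / b) * φ x| ≤ H y - H x := by
    intro x hx y hy hxy
    have h1 := hG ((x - t) / b) ((y - t) / b) (by gcongr)
    have h2 := hQ x hx y hy
    rw [abs_of_nonneg (sub_nonneg.2 hxy)] at h2
    have h3 : Kv ((y - t) / b) * φ y - Kv ((x - t) / b) * φ x =
        φ y * (Kv ((y - t) / b) - Kv ((x - t) / b)) + Kv ((x - t) / b) * (φ y - φ x) := by ring
    calc |Kv ((y - t) / b) * φ y - Kv ((x - t) / b) * φ x|
        ≤ |φ y| * |Kv ((y - t) / b) - Kv ((x - t) / b)| + |Kv ((x - t) / b)| * |φ y - φ x| := by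
          rw [h3, ← abs_mul, ← abs_mul]
          exact abs_add_le _ _
      _ ≤ P * (G ((y - t) / b) - G ((x - t) / b)) + M * (Q * (y - x)) :=
          add_le_add (mul_le_mul (hP y hy) h1 (abs_nonneg _) hP0)
            (mul_le_mul (hM _) h2 (abs_nonneg _) hM0)
      _ = H y - H x := by simp only [H]; ring
  have hsum : |S - ∫ x in (0 : ℝ)..1, Kv ((x - t) / b) * φ x| ≤
      β⁻¹ * (P * (2 * L + 2 * M) + M * Q) := by
    have h1 := abs_riemann_sum_sub_integral_le (f := fun x => Kv ((x - t) / b) * φ x) (H := H)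
      (fun j hj => (hmono j hj).le) hmesh (by rwa [htp0, htpN])
    simp only [← mul_assoc, htp0, htpN] at h1
    refine h1.trans (mul_le_mul_of_nonneg_left ?_ hβ)
    have h2 := mul_le_mul_of_nonneg_left (hGV ((0 - t) / b) ((1 - t) / b)) hP0
    simp only [H]
    linarith
  have hbias := abs_integral_kernel_sub_iteratedDerivWithin_le (by omega) hKcont hM hordv
    (fun j hj => hord0 j (by omega)) hφcont hb hA0 (t := t) (by linarith) (by linarith)
    (hA t ⟨by linarith [hδ.1], by linarith [hδ.1]⟩)
  rw [integral_rescaled_kernel_mul hsupp hb (by linarith) (by linarith)] at hsum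
  set J := ∫ u in (-1 : ℝ)..1, Kv u * φ (t + b * u)
  have hsq : ((-1 : ℝ) ^ v) * (-1) ^ v = 1 := by rw [← mul_pow]; norm_num
  have hsplit : (-1 : ℝ) ^ v / b ^ (v + 1) * S - D =
      (-1) ^ v * (b ^ (v + 1))⁻¹ * ((S - b * J) + b * (J - (-1) ^ v * b ^ v * D)) := by
    have hbv : (b ^ (v + 1))⁻¹ * (b * b ^ v) = 1 := by
      rw [pow_succ']
      exact inv_mul_cancel₀ (by positivity)
    linear_combination D * hsq + D * (-1 : ℝ) ^ v * (-1) ^ v * hbv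
  have hpow : b ^ (n + 1) * b = b ^ (n + 1 - v) * b ^ (v + 1) := by
    rw [← pow_succ, ← pow_add]
    congr 1
    omega
  rw [hsplit, abs_mul, abs_mul, abs_pow, abs_neg, abs_one, one_pow, one_mul,
    abs_of_pos (inv_pos.2 (pow_pos hb (v + 1)))]
  calc (b ^ (v + 1))⁻¹ * |(S - b * J) + b * (J - (-1) ^ v * b ^ v * D)|
      ≤ (b ^ (v + 1))⁻¹ * (β⁻¹ * (P * (2 * L + 2 * M) + M * Q) +
          b * (2 * M * A * b ^ (n + 1))) := by
        gcongr
        refine (abs_add_le _ _).trans (add_le_add hsum ?_)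
        rw [abs_mul, abs_of_pos hb]
        gcongr
    _ = _ := by
        rw [mul_inv, mul_add]
        have hbv : (b ^ (v + 1))⁻¹ * b ^ (v + 1) = 1 := inv_mul_cancel₀ (by positivity)
        linear_combination (b ^ (v + 1))⁻¹ * (2 * M * A) * hpow +
          2 * M * A * b ^ (n + 1 - v) * hbv
end

section
/- Let v ≤ k − 2 be natural numbers, μ : [0,1] → ℝ k-times continuously differentiable, δ ∈ (0, 1/2), and K : ℝ → ℝ (v+1)-times continuously differentiable on [−1,1], zero outside [−1,1], with K^{(i)}(−1) = K^{(i)}(1) = 0 for i = 0,…,v−1 and K^{(v)} of order (v,k). Let (n_m) be natural numbers, (b_m) ⊂ (0, δ) bandwidths and (t_{m,j})_{j=0}^{N_m} partitions of [0,1] with spacings at most β_m^{−1} ≤ b_m, and suppose n_m → ∞, b_m → 0, n_m b_m^{2(k−v)} → 0, and n_m (b_m^{v+1} β_m)^{−2} → 0. Then √(n_m) · sup_{t ∈ [δ, 1−δ]} | (−1)^v b_m^{−(v+1)} Σ_{j=1}^{N_m} (t_{m,j} − t_{m,j−1}) K^{(v)}((t_{m,j} − t)/b_m) μ(t_{m,j})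 − μ^{(v)}(t) | → 0 as m → ∞. -/
open MeasureTheory Set Finset Filter

/-- A derivative of order below the smoothness order is bounded and Lipschitz on a compact
interval, with a common constant. -/
lemma exists_bound_lipschitz_iteratedDerivWithin {f : ℝ → ℝ} {a b : ℝ} {m n : ℕ} (hab : a < b)
    (hf : ContDiffOn ℝ n f (Set.Icc a b)) (hmn : m < n) :
    ∃ C, 0 ≤ C ∧ (∀ x ∈ Set.Icc a b, |iteratedDerivWithin m f (Set.Icc a b) x| ≤ C) ∧
      ∀ x ∈ Set.Icc a b, ∀ y ∈ Set.Icc a b,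
        |iteratedDerivWithin m f (Set.Icc a b) y - iteratedDerivWithin m f (Set.Icc a b) x|
          ≤ C * |y - x| := by
  have hu := uniqueDiffOn_Icc hab
  obtain ⟨A, hA⟩ := isCompact_Icc.exists_bound_of_continuousOn
    (hf.continuousOn_iteratedDerivWithin (by exact_mod_cast hmn.le) hu)
  obtain ⟨B, hB⟩ := isCompact_Icc.exists_bound_of_continuousOn
    (hf.continuousOn_iteratedDerivWithin (m := m + 1) (by exact_mod_cast hmn) hu)
  refine ⟨max A B, ?_, fun x hx => (hA x hx).trans (le_max_left _ _), fun x hx y hy => ?_⟩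
  · exact (norm_nonneg _).trans ((hA a ⟨le_rfl, hab.le⟩).trans (le_max_left _ _))
  · refine (convex_Icc a b).norm_image_sub_le_of_norm_derivWithin_le
      (hf.differentiableOn_iteratedDerivWithin (by exact_mod_cast hmn) hu) (fun z hz => ?_) hx hy
    rw [← iteratedDerivWithin_succ]
    exact (hB z hz).trans (le_max_right _ _)

/-- Taylor's theorem on a compact interval with a remainder bound uniform in the centre, which
need not be an endpoint. -/
lemma exists_abs_sub_taylorWithinEval_le {f : ℝ → ℝ} {a b : ℝ} {n : ℕ} (hab : a < b)
    (hf : ContDiffOn ℝ (n + 1 : ℕ) f (Set.Icc a b)) :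
    ∃ C, 0 ≤ C ∧ ∀ x ∈ Set.Icc a b, ∀ t ∈ Set.Icc a b,
      |f x - taylorWithinEval f n (Set.Icc a b) t x| ≤ C * |x - t| ^ (n + 1) := by
  have hu := uniqueDiffOn_Icc hab
  obtain ⟨B, hB⟩ := isCompact_Icc.exists_bound_of_continuousOn
    (hf.continuousOn_iteratedDerivWithin (m := n + 1) le_rfl hu)
  have hB0 : 0 ≤ B := (norm_nonneg _).trans (hB a ⟨le_rfl, hab.le⟩)
  refine ⟨B, hB0, fun x hx t ht => ?_⟩
  have hsub : Set.uIcc t x ⊆ Set.Icc a b := (convex_Icc a b).ordConnected.uIcc_subset ht hx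
  have key := Convex.norm_image_sub_le_of_norm_hasDerivWithin_le
    (f := fun y => taylorWithinEval f n (Set.Icc a b) y x) (s := Set.uIcc t x) (x := t) (y := x)
    (C := |x - t| ^ n * B)
    (fun y hy => (hasDerivWithinAt_taylorWithinEval_at_Icc x hab (hsub hy)
      (hf.of_le (by exact_mod_cast n.le_succ))
      (hf.differentiableOn_iteratedDerivWithin (by exact_mod_cast n.lt_succ_self) hu)).mono hsub)
    (fun y hy => ?_) (convex_uIcc t x) Set.left_mem_uIcc Set.right_mem_uIcc
  · simp only [taylorWithinEval_self, Real.norm_eq_abs] at key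
    refine key.trans_eq ?_
    ring
  · have h1 : |x - y| ≤ |x - t| := Set.abs_sub_right_of_mem_uIcc hy
    have h2 : ((n.factorial : ℝ))⁻¹ ≤ 1 := inv_le_one_of_one_le₀ (by exact_mod_cast n.factorial_pos)
    rw [norm_smul, norm_mul, norm_pow, Real.norm_eq_abs, Real.norm_eq_abs,
      abs_of_nonneg (by positivity : (0 : ℝ) ≤ ((n.factorial : ℝ))⁻¹)]
    refine mul_le_mul ?_ (hB y (hsub hy)) (norm_nonneg _) (by positivity)
    calc ((n.factorial : ℝ))⁻¹ * |x - y| ^ n ≤ 1 * |x - t| ^ n := by gcongr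
      _ = _ := one_mul _

/-- A function that is bounded and Lipschitz on `[-1,1]` and vanishes elsewhere has its increments
dominated by those of a bounded function. -/
lemma exists_increment_control {g : ℝ → ℝ} {C : ℝ} (hC : 0 ≤ C)
    (hzero : ∀ x ∉ Set.Icc (-1 : ℝ) 1, g x = 0) (hbd : ∀ x ∈ Set.Icc (-1 : ℝ) 1, |g x| ≤ C)
    (hlip : ∀ x ∈ Set.Icc (-1 : ℝ) 1, ∀ y ∈ Set.Icc (-1 : ℝ) 1, |g y - g x| ≤ C * |y - x|) :
    ∃ Φ : ℝ → ℝ, (∀ x y, x ≤ y → |g y - g x| ≤ Φ y - Φ x) ∧ ∀ x y, Φ y - Φ x ≤ 4 * C := by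
  refine ⟨fun x => C * (if x < -1 then -1 else if x ≤ 1 then x + 1 else 3), ?_, ?_⟩
  · intro x y hxy
    rw [← mul_sub]
    rcases lt_or_ge x (-1) with hx | hx <;> rcases le_or_gt y 1 with hy | hy
    · rw [hzero x (fun h => by linarith [h.1])]
      rcases lt_or_ge y (-1) with hy' | hy'
      · rw [hzero y (fun h => by linarith [h.1])]; simp [hx, hy']
      · have := hbd y ⟨hy', hy⟩
        simp only [hx, hy, not_lt.2 hy', if_true, if_false, sub_zero]
        nlinarith
    · rw [hzero x (fun h => by linarith [h.1]), hzero y (fun h => by linarith [h.2])]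
      simp only [hx, not_le.2 hy, not_lt.2 (by linarith : (-1 : ℝ) ≤ y), if_true, if_false]
      norm_num; positivity
    · have := hlip x ⟨hx, by linarith⟩ y ⟨by linarith, hy⟩
      rw [abs_of_nonneg (sub_nonneg.2 hxy)] at this
      simp only [not_lt.2 hx, not_lt.2 (hx.trans hxy), hy, hxy.trans hy, if_true, if_false]
      linarith
    · rw [hzero y (fun h => by linarith [h.2])]
      simp only [not_lt.2 hx, not_lt.2 (hx.trans hxy), not_le.2 hy, if_false]
      rcases le_or_gt x 1 with hx' | hx'
      · have := hbd x ⟨hx, hx'⟩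
        simp only [hx', if_true, zero_sub, abs_neg]
        nlinarith
      · rw [hzero x (fun h => by linarith [h.2])]; simp [not_le.2 hx']
  · intro x y
    rw [← mul_sub, mul_comm]
    refine mul_le_mul_of_nonneg_right ?_ hC
    split_ifs <;> linarith

/-- The error of a right-endpoint Riemann sum is at most the mesh times a bound for the total
increment. -/
lemma abs_riemannSum_sub_integral_le_s19 {f Ψ : ℝ → ℝ} {h : ℝ} {N : ℕ} {s : ℕ → ℝ}
    (hs : ∀ j < N, s j ≤ s (j + 1)) (hmesh : ∀ j < N, s (j + 1) - s j ≤ h)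
    (hf : ∀ x ∈ Set.Icc (s 0) (s N), ∀ y ∈ Set.Icc (s 0) (s N), x ≤ y →
      |f y - f x| ≤ Ψ y - Ψ x) :
    |∑ j ∈ Finset.range N, (s (j + 1) - s j) * f (s (j + 1)) - ∫ x in s 0..s N, f x|
      ≤ h * (Ψ (s N) - Ψ (s 0)) := by
  have hsub : ∀ i j, i ≤ j → j ≤ N → s i ≤ s j := fun i j hij => by
    induction j, hij using Nat.le_induction with
    | base => exact fun _ => le_rfl
    | succ j _ ih => exact fun hj => (ih (by omega)).trans (hs j (by omega))
  have hmem : ∀ j < N, Set.Icc (s j) (s (j + 1)) ⊆ Set.Icc (s 0) (s N) := fun j hj =>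
    Set.Icc_subset_Icc (hsub 0 j (by omega) hj.le) (hsub (j + 1) N hj le_rfl)
  have hfint : ∀ j < N, IntervalIntegrable f volume (s j) (s (j + 1)) := fun j hj => by
    have h1 : MonotoneOn Ψ (Set.uIcc (s j) (s (j + 1))) := fun x hx y hy hxy => by
      rw [Set.uIcc_of_le (hs j hj)] at hx hy
      linarith [abs_nonneg (f y - f x), hf x (hmem j hj hx) y (hmem j hj hy) hxy]
    have h2 : MonotoneOn (fun x => f x + Ψ x) (Set.uIcc (s j) (s (j + 1))) :=
      fun x hx y hy hxy => by
        rw [Set.uIcc_of_le (hs j hj)] at hx hy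
        have := (abs_le.1 (hf x (hmem j hj hx) y (hmem j hj hy) hxy)).1
        simp only
        linarith
    simpa using h2.intervalIntegrable.sub h1.intervalIntegrable
  rw [← intervalIntegral.sum_integral_adjacent_intervals hfint, ← Finset.sum_sub_distrib,
    ← Finset.sum_range_sub (fun j => Ψ (s j)), Finset.mul_sum]
  refine (Finset.abs_sum_le_sum_abs _ _).trans (Finset.sum_le_sum fun j hj => ?_)
  have hj := Finset.mem_range.1 hj
  have hle := hs j hj
  have hΨ := hf (s j) (hmem j hj ⟨le_rfl, hle⟩) (s (j + 1)) (hmem j hj ⟨hle, le_rfl⟩) hle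
  have hbound : ∀ x ∈ Set.uIoc (s j) (s (j + 1)),
      ‖f (s (j + 1)) - f x‖ ≤ Ψ (s (j + 1)) - Ψ (s j) := fun x hx => by
    rw [Set.uIoc_of_le hle] at hx
    have hx' : x ∈ Set.Icc (s j) (s (j + 1)) := ⟨hx.1.le, hx.2⟩
    have h1 := hf x (hmem j hj hx') (s (j + 1)) (hmem j hj ⟨hle, le_rfl⟩) hx.2
    have h2 := hf (s j) (hmem j hj ⟨le_rfl, hle⟩) x (hmem j hj hx') hx.1.le
    rw [Real.norm_eq_abs]
    linarith [abs_nonneg (f x - f (s j))]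
  have hcalc : (s (j + 1) - s j) * f (s (j + 1)) - ∫ x in s j..s (j + 1), f x
      = ∫ x in s j..s (j + 1), (f (s (j + 1)) - f x) := by
    rw [intervalIntegral.integral_sub (by simp) (hfint j hj)]; simp
  rw [hcalc]
  refine (intervalIntegral.norm_integral_le_of_norm_le_const hbound).trans ?_
  rw [abs_of_nonneg (sub_nonneg.2 hle), mul_comm]
  exact mul_le_mul_of_nonneg_right (hmesh j hj) ((abs_nonneg _).trans hΨ)

/-- Substitution in the convolution integral for a kernel supported in `[-1,1]`. -/
lemma integral_kernel_rescale {g μ : ℝ → ℝ} {b t : ℝ} (hb : 0 < b) (h0 : 0 ≤ t - b)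
    (h1 : t + b ≤ 1) (hzero : ∀ x ∉ Set.Icc (-1 : ℝ) 1, g x = 0) :
    ∫ x in (0 : ℝ)..1, g ((x - t) / b) * μ x = b * ∫ u in (-1 : ℝ)..1, g u * μ (t + b * u) := by
  have hr : ∫ x in (0 : ℝ)..1, g ((x - t) / b) * μ x
      = ∫ x in (t - b)..(t + b), g ((x - t) / b) * μ x := by
    rw [intervalIntegral.integral_of_le zero_le_one, intervalIntegral.integral_of_le (by linarith),
      ← integral_Icc_eq_integral_Ioc, ← integral_Icc_eq_integral_Ioc]
    refine setIntegral_eq_of_subset_of_forall_sdiff_eq_zero measurableSet_Icc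
      (Set.Icc_subset_Icc h0 h1) fun x hx => ?_
    rw [hzero, zero_mul]
    rintro ⟨h2, h3⟩
    rw [le_div_iff₀ hb] at h2
    rw [div_le_iff₀ hb] at h3
    exact hx.2 ⟨by linarith, by linarith⟩
  have hs := intervalIntegral.integral_comp_mul_add (a := -1) (b := 1)
    (fun x => g ((x - t) / b) * μ x) hb.ne' t
  rw [show b * -1 + t = t - b by ring, show b * 1 + t = t + b by ring] at hs
  rw [hr, eq_comm, ← mul_right_inj' (inv_ne_zero hb.ne'), inv_mul_cancel_left₀ hb.ne',
    ← smul_eq_mul, ← hs]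
  refine intervalIntegral.integral_congr fun u _ => ?_
  simp only [add_sub_cancel_right, mul_div_cancel_left₀ u hb.ne', add_comm t]

/-- The smoothing error of a kernel of order `(v, p + 1)` is `O(b ^ (p + 1))`. -/
lemma abs_integral_kernel_sub_le {g μ : ℝ → ℝ} {b t C D : ℝ} {v p : ℕ} (hb : 0 < b)
    (hvp : v ≤ p) (hD : 0 ≤ D) (hg : ContinuousOn g (Set.Icc (-1 : ℝ) 1))
    (hbd : ∀ x ∈ Set.Icc (-1 : ℝ) 1, |g x| ≤ C)
    (hμ : ContinuousOn (fun u => μ (t + b * u)) (Set.Icc (-1 : ℝ) 1))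
    (htaylor : ∀ u ∈ Set.Icc (-1 : ℝ) 1,
      |μ (t + b * u) - taylorWithinEval μ p (Set.Icc (0 : ℝ) 1) t (t + b * u)|
        ≤ D * |t + b * u - t| ^ (p + 1))
    (hordv : ∫ x in (-1 : ℝ)..1, x ^ v * g x = (-1 : ℝ) ^ v * (v.factorial : ℝ))
    (hord0 : ∀ j < p + 1, j ≠ v → ∫ x in (-1 : ℝ)..1, x ^ j * g x = 0) :
    |(∫ u in (-1 : ℝ)..1, g u * μ (t + b * u))
        - (-1) ^ v * b ^ v * iteratedDerivWithin v μ (Set.Icc (0 : ℝ) 1) t|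
      ≤ 2 * C * D * b ^ (p + 1) := by
  have huIcc : Set.uIcc (-1 : ℝ) 1 = Set.Icc (-1) 1 := Set.uIcc_of_le (by norm_num)
  have hmoment : ∫ u in (-1 : ℝ)..1,
      g u * taylorWithinEval μ p (Set.Icc (0 : ℝ) 1) t (t + b * u)
      = (-1) ^ v * b ^ v * iteratedDerivWithin v μ (Set.Icc (0 : ℝ) 1) t := by
    have hexp : ∀ u : ℝ, g u * taylorWithinEval μ p (Set.Icc (0 : ℝ) 1) t (t + b * u)
        = ∑ j ∈ Finset.range (p + 1), ((j.factorial : ℝ)⁻¹ * b ^ j *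
          iteratedDerivWithin j μ (Set.Icc (0 : ℝ) 1) t) * (u ^ j * g u) := fun u => by
      rw [taylor_within_apply, Finset.mul_sum]
      refine Finset.sum_congr rfl fun j _ => ?_
      rw [add_sub_cancel_left, smul_eq_mul, mul_pow]
      ring
    simp only [hexp]
    rw [intervalIntegral.integral_finsetSum]
    · simp only [intervalIntegral.integral_const_mul]
      rw [Finset.sum_eq_single_of_mem v (Finset.mem_range.2 (by omega)), hordv]
      · have : (v.factorial : ℝ) ≠ 0 := by exact_mod_cast v.factorial_ne_zero
        field_simp
      · intro j hj hjv
        rw [hord0 j (Finset.mem_range.1 hj) hjv, mul_zero]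
    · intro j _
      refine ContinuousOn.intervalIntegrable ?_
      rw [huIcc]
      fun_prop
  have hT : Continuous fun u => taylorWithinEval μ p (Set.Icc (0 : ℝ) 1) t (t + b * u) := by
    simp only [taylor_within_apply]
    fun_prop
  rw [← hmoment, ← intervalIntegral.integral_sub]
  · have h := intervalIntegral.norm_integral_le_of_norm_le_const (a := -1) (b := 1)
      (f := fun u => g u * μ (t + b * u)
        - g u * taylorWithinEval μ p (Set.Icc (0 : ℝ) 1) t (t + b * u))
      (C := C * (D * b ^ (p + 1))) fun u hu => ?_
    · refine h.trans_eq ?_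
      rw [show |(1 : ℝ) - -1| = 2 by norm_num]
      ring
    · rw [Set.uIoc_of_le (by norm_num)] at hu
      have hu' : u ∈ Set.Icc (-1 : ℝ) 1 := ⟨hu.1.le, hu.2⟩
      rw [← mul_sub, Real.norm_eq_abs, abs_mul]
      refine mul_le_mul (hbd u hu') ((htaylor u hu').trans ?_) (abs_nonneg _)
        ((abs_nonneg _).trans (hbd u hu'))
      rw [add_sub_cancel_left, abs_mul, abs_of_pos hb]
      have : |u| ≤ 1 := abs_le.2 hu'
      gcongr
      exact mul_le_of_le_one_right hb.le this
  · refine ContinuousOn.intervalIntegrable ?_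
    rw [huIcc]
    exact hg.mul hμ
  · refine ContinuousOn.intervalIntegrable ?_
    rw [huIcc]
    exact hg.mul hT.continuousOn

/-- First step of the proof of Theorem 2: under `n b^{2(k-v)} → 0` and
`n (b^{v+1} β)^{-2} → 0`, the bias of the Priestley–Chao estimator of `μ⁽ᵛ⁾` is
uniformly negligible at the `√n` scale:
`√n sup_{t ∈ [δ,1-δ]} |E[μ̂⁽ᵛ⁾(t)] - μ⁽ᵛ⁾(t)| → 0`. -/
theorem stmt_19 (v k : ℕ) (hvk : v + 2 ≤ k)
    (μ : ℝ → ℝ) (hμ : ContDiffOn ℝ k μ (Set.Icc (0 : ℝ) 1))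
    (δ : ℝ) (hδ : δ ∈ Set.Ioo (0 : ℝ) (1 / 2))
    (K Kv : ℝ → ℝ) (hK : ContDiffOn ℝ (v + 1) K (Set.Icc (-1 : ℝ) 1))
    (hKsupp : ∀ x : ℝ, x ∉ Set.Icc (-1 : ℝ) 1 → K x = 0)
    (hKbound : ∀ i < v, iteratedDerivWithin i K (Set.Icc (-1 : ℝ) 1) (-1) = 0 ∧
      iteratedDerivWithin i K (Set.Icc (-1 : ℝ) 1) 1 = 0)
    (hKv : ∀ x : ℝ, Kv x =
      if x ∈ Set.Icc (-1 : ℝ) 1 then iteratedDerivWithin v K (Set.Icc (-1 : ℝ) 1) x else 0)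
    -- `Kv = K⁽ᵛ⁾` is of order `(v,k)`
    (hordv : ∫ x in (-1 : ℝ)..1, x ^ v * Kv x = (-1 : ℝ) ^ v * (v.factorial : ℝ))
    (hord0 : ∀ j < k, j ≠ v → ∫ x in (-1 : ℝ)..1, x ^ j * Kv x = 0)
    (hordk : ∫ x in (-1 : ℝ)..1, x ^ k * Kv x ≠ 0)
    (n N : ℕ → ℕ) (b β : ℕ → ℝ) (tp : ℕ → ℕ → ℝ)
    (hb : ∀ m, b m ∈ Set.Ioo (0 : ℝ) δ)
    (hpart0 : ∀ m, tp m 0 = 0) (hpart1 : ∀ m, tp m (N m) = 1)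
    (hmono : ∀ m, ∀ j < N m, tp m j < tp m (j + 1))
    (hmesh : ∀ m, ∀ j < N m, tp m (j + 1) - tp m j ≤ (β m)⁻¹)
    (hβb : ∀ m, (β m)⁻¹ ≤ b m)
    (hn : Tendsto (fun m => n m) atTop atTop)
    (hb0 : Tendsto b atTop (nhds 0))
    (hcond1 : Tendsto (fun m => (n m : ℝ) * b m ^ (2 * (k - v))) atTop (nhds 0))
    (hcond2 : Tendsto (fun m => (n m : ℝ) * ((b m ^ (v + 1) * β m) ^ 2)⁻¹) atTop (nhds 0)) :
    Tendsto
      (fun m => Real.sqrt (n m) *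
        ⨆ t : Set.Icc δ (1 - δ),
          |(-1 : ℝ) ^ v / b m ^ (v + 1) *
              (∑ j ∈ Finset.range (N m),
                (tp m (j + 1) - tp m j) * Kv ((tp m (j + 1) - (t : ℝ)) / b m) * μ (tp m (j + 1))) -
            iteratedDerivWithin v μ (Set.Icc (0 : ℝ) 1) (t : ℝ)|)
      atTop (nhds 0) := by
  have hu : UniqueDiffOn ℝ (Set.Icc (-1 : ℝ) 1) := uniqueDiffOn_Icc (by norm_num)
  obtain ⟨p, rfl⟩ : ∃ p, k = p + 1 := ⟨k - 1, by omega⟩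
  have hK' : ContDiffOn ℝ (v + 1 : ℕ) K (Set.Icc (-1 : ℝ) 1) := by exact_mod_cast hK
  obtain ⟨C, hC, hGbd, hGlip⟩ := exists_bound_lipschitz_iteratedDerivWithin
    (by norm_num : (-1 : ℝ) < 1) hK' v.lt_succ_self
  have hKvG : Set.EqOn Kv (iteratedDerivWithin v K (Set.Icc (-1 : ℝ) 1)) (Set.Icc (-1 : ℝ) 1) :=
    fun x hx => by rw [hKv, if_pos hx]
  have hKvzero : ∀ x ∉ Set.Icc (-1 : ℝ) 1, Kv x = 0 := fun x hx => by rw [hKv, if_neg hx]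
  have hKvbd : ∀ x ∈ Set.Icc (-1 : ℝ) 1, |Kv x| ≤ C := fun x hx => by
    rw [hKvG hx]; exact hGbd x hx
  have hKvbd' : ∀ x, |Kv x| ≤ C := fun x => by
    by_cases hx : x ∈ Set.Icc (-1 : ℝ) 1
    · exact hKvbd x hx
    · rw [hKvzero x hx, abs_zero]; exact hC
  have hKvcont : ContinuousOn Kv (Set.Icc (-1 : ℝ) 1) :=
    (hK'.continuousOn_iteratedDerivWithin (by exact_mod_cast v.le_succ) hu).congr hKvG
  obtain ⟨Φ, hΦ, hΦbd⟩ := exists_increment_control hC hKvzero hKvbd fun x hx y hy => by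
    rw [hKvG hx, hKvG hy]; exact hGlip x hx y hy
  obtain ⟨A, hA, hμbd, hμlip⟩ := exists_bound_lipschitz_iteratedDerivWithin (m := 0)
    zero_lt_one hμ p.succ_pos
  simp only [iteratedDerivWithin_zero] at hμbd hμlip
  obtain ⟨D, hD, hTaylor⟩ := exists_abs_sub_taylorWithinEval_le zero_lt_one hμ
  have hβ : ∀ m, 0 ≤ β m := fun m => by
    have hN : 0 < N m := Nat.pos_of_ne_zero fun h => by
      have := hpart1 m
      rw [h, hpart0] at this
      exact zero_ne_one this
    exact inv_nonneg.1 (by linarith [hmono m 0 hN, hmesh m 0 hN])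
  have hriemann : ∀ m, ∀ t : ℝ,
      |∑ j ∈ Finset.range (N m),
          (tp m (j + 1) - tp m j) * Kv ((tp m (j + 1) - t) / b m) * μ (tp m (j + 1))
        - ∫ x in (0 : ℝ)..1, Kv ((x - t) / b m) * μ x| ≤ (β m)⁻¹ * (5 * C * A) := fun m t => by
    have h := abs_riemannSum_sub_integral_le_s19 (f := fun x => Kv ((x - t) / b m) * μ x)
      (Ψ := fun x => A * Φ ((x - t) / b m) + C * A * x) (s := tp m)
      (fun j hj => (hmono m j hj).le) (hmesh m) fun x hx y hy hxy => ?_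
    · rw [hpart0, hpart1] at h
      simp only [← mul_assoc] at h ⊢
      refine h.trans ?_
      have := mul_le_mul_of_nonneg_left (hΦbd ((0 - t) / b m) ((1 - t) / b m)) hA
      simp only [mul_assoc (β m)⁻¹]
      refine mul_le_mul_of_nonneg_left ?_ (inv_nonneg.2 (hβ m))
      linarith
    · rw [hpart0, hpart1] at hx hy
      have h1 := hΦ ((x - t) / b m) ((y - t) / b m)
        (div_le_div_of_nonneg_right (by linarith) (hb m).1.le)
      have h2 := hμlip x hx y hy
      rw [abs_of_nonneg (sub_nonneg.2 hxy)] at h2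
      calc |Kv ((y - t) / b m) * μ y - Kv ((x - t) / b m) * μ x|
          = |(Kv ((y - t) / b m) - Kv ((x - t) / b m)) * μ y
              + Kv ((x - t) / b m) * (μ y - μ x)| := by ring_nf
        _ ≤ |Kv ((y - t) / b m) - Kv ((x - t) / b m)| * |μ y|
              + |Kv ((x - t) / b m)| * |μ y - μ x| := by
            rw [← abs_mul, ← abs_mul]; exact abs_add_le _ _
        _ ≤ (Φ ((y - t) / b m) - Φ ((x - t) / b m)) * A + C * (A * (y - x)) :=
            add_le_add (mul_le_mul h1 (hμbd y hy) (abs_nonneg _) ((abs_nonneg _).trans h1))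
              (mul_le_mul (hKvbd' _) h2 (abs_nonneg _) hC)
        _ = _ := by ring
  have hbias : ∀ m, ∀ t ∈ Set.Icc δ (1 - δ),
      |(∫ x in (0 : ℝ)..1, Kv ((x - t) / b m) * μ x)
        - b m * ((-1) ^ v * b m ^ v * iteratedDerivWithin v μ (Set.Icc (0 : ℝ) 1) t)|
        ≤ b m * (2 * C * D * b m ^ (p + 1)) := fun m t ht => by
    obtain ⟨hb0, hbδ⟩ := hb m
    have hmem : ∀ u ∈ Set.Icc (-1 : ℝ) 1, t + b m * u ∈ Set.Icc (0 : ℝ) 1 := fun u hu =>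
      ⟨by nlinarith [hu.1, ht.1], by nlinarith [hu.2, ht.2]⟩
    rw [integral_kernel_rescale hb0 (by linarith [ht.1]) (by linarith [ht.2]) hKvzero, ← mul_sub,
      abs_mul, abs_of_pos hb0]
    refine mul_le_mul_of_nonneg_left (abs_integral_kernel_sub_le hb0 (by omega) hD hKvcont hKvbd
      (hμ.continuousOn.comp (by fun_prop) hmem) (fun u hu => hTaylor _ (hmem u hu) t
        ⟨by linarith [ht.1], by linarith [ht.2]⟩) hordv hord0) hb0.le
  have hlim : Tendsto (fun m =>
      5 * C * A * Real.sqrt ((n m : ℝ) * ((b m ^ (v + 1) * β m) ^ 2)⁻¹)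
        + 2 * C * D * Real.sqrt ((n m : ℝ) * b m ^ (2 * (p + 1 - v)))) atTop (nhds 0) := by
    simpa using (hcond2.sqrt.const_mul (5 * C * A)).add (hcond1.sqrt.const_mul (2 * C * D))
  refine squeeze_zero (fun m => mul_nonneg (Real.sqrt_nonneg _)
    (Real.iSup_nonneg fun _ => abs_nonneg _)) (fun m => ?_) hlim
  have hb0 := (hb m).1
  have hβ0 := hβ m
  rw [Real.sqrt_mul (Nat.cast_nonneg _), Real.sqrt_mul (Nat.cast_nonneg _), Real.sqrt_inv,
    Real.sqrt_sq (by positivity), mul_comm 2 (p + 1 - v), pow_mul, Real.sqrt_sq (by positivity)]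
  have hne : Nonempty (Set.Icc δ (1 - δ)) := ⟨⟨δ, le_rfl, by linarith [hδ.2]⟩⟩
  refine (mul_le_mul_of_nonneg_left (ciSup_le fun t => ?_) (Real.sqrt_nonneg _)).trans_eq
    (?_ : Real.sqrt (n m) * (((b m) ^ (v + 1))⁻¹ * ((β m)⁻¹ * (5 * C * A)
      + b m * (2 * C * D * b m ^ (p + 1)))) = _)
  · have h1 := hriemann m t
    have h2 := hbias m t t.2
    set S := ∑ j ∈ Finset.range (N m),
      (tp m (j + 1) - tp m j) * Kv ((tp m (j + 1) - (t : ℝ)) / b m) * μ (tp m (j + 1))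
    set I := ∫ x in (0 : ℝ)..1, Kv ((x - t) / b m) * μ x
    set d := iteratedDerivWithin v μ (Set.Icc (0 : ℝ) 1) t
    have hsq : ((-1 : ℝ) ^ v) * (-1) ^ v = 1 := by rw [← mul_pow]; norm_num
    have heq : (-1 : ℝ) ^ v / b m ^ (v + 1) * S - d
        = (-1 : ℝ) ^ v * (b m ^ (v + 1))⁻¹
          * ((S - I) + (I - b m * ((-1) ^ v * b m ^ v * d))) := by
      have : (b m ^ (v + 1))⁻¹ * (b m * b m ^ v) = 1 := by
        rw [← pow_succ']; exact inv_mul_cancel₀ (by positivity)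
      linear_combination d * this + d * ((b m ^ (v + 1))⁻¹ * (b m * b m ^ v)) * hsq
    rw [heq, abs_mul, abs_mul, abs_pow, abs_neg, abs_one, one_pow, one_mul,
      abs_of_nonneg (by positivity : 0 ≤ (b m ^ (v + 1))⁻¹)]
    exact mul_le_mul_of_nonneg_left ((abs_add_le _ _).trans (add_le_add h1 h2)) (by positivity)
  · have : b m * b m ^ (p + 1) = b m ^ (v + 1) * b m ^ (p + 1 - v) := by
      rw [← pow_succ', ← pow_add]; congr 1; omega
    have h3 : (b m ^ (v + 1))⁻¹ * (b m * b m ^ (p + 1)) = b m ^ (p + 1 - v) := by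
      rw [this, inv_mul_cancel_left₀ (by positivity)]
    rw [mul_inv]
    linear_combination (Real.sqrt (n m) * (2 * C * D)) * h3
end
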